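/- arXiv:1710.06131 — 4 statements merged into one kernel-verified Lean document; each statement's English description precedes it below -/
import Mathlib

section
/- Let q be a power of an odd prime p. If n = p or n = 2p, then there exists a primitive 1-normal element of F_{q^n} over F_q. -/
open Polynomial
noncomputable section

/-- For `f = Σ aᵢ xⁱ ∈ F_q[x]` and `α` in an extension, `f ∘ α = Σ aᵢ α^(qⁱ)`. -/
def frobComp {F K : Type*} [Field F] [Field K] [Algebra F K] (q : ℕ) (f : F[X]) (α : K) : K :=
  ∑ i ∈ Finset.range (f.natDegree + 1), algebraMap F K (f.coeff i) * α ^ q ^ i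

/-- `g` is the minimal polynomial of `α` with respect to the Frobenius `σ_q`:
monic, annihilates `α` under `∘`, and has least degree with these properties. -/
def IsFrobMinimal {F K : Type*} [Field F] [Field K] [Algebra F K] (q : ℕ) (g : F[X]) (α : K) :
    Prop :=
  g.Monic ∧ frobComp q g α = 0 ∧
    ∀ h : F[X], h.Monic → frobComp q h α = 0 → g.natDegree ≤ h.natDegree

/-- `α ∈ F_{qⁿ}` is `k`-normal over `F_q` if the `F_q`-span of `{α, α^q, …, α^(q^(n-1))}`
has dimension `n - k`. -/
def IskNormal (q n k : ℕ) (F : Type*) {K : Type*} [Field F] [Field K] [Algebra F K] (α : K) :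
    Prop :=
  Module.finrank F (Submodule.span F (Set.range fun i : Fin n => α ^ q ^ (i : ℕ))) = n - k

/-- `α` is primitive: it generates the multiplicative group of the field. -/
def IsPrimitiveElt {K : Type*} [Field K] (α : K) : Prop :=
  ∀ b : K, b ≠ 0 → ∃ m : ℕ, α ^ m = b

/-- `α` is `m`-free: `gcd(m, (xⁿ - 1)/m_{σ_q,α}) = 1`. -/
def IsPolyFree {F K : Type*} [Field F] [Field K] [Algebra F K] (q n : ℕ) (m : F[X]) (α : K) :
    Prop :=
  ∀ g : F[X], IsFrobMinimal q g α → IsCoprime m ((X ^ n - 1) /ₘ g)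

/-- `W(t)`: number of squarefree divisors of a positive integer `t`. -/
def Wint (t : ℕ) : ℕ := Set.ncard {d : ℕ | d ∣ t ∧ Squarefree d}

/-- `W(g)`: number of monic divisors of the polynomial `g`. -/
def Wpoly {F : Type*} [Field F] (g : F[X]) : ℕ := Set.ncard {h : F[X] | h.Monic ∧ h ∣ g}

/-- `Φ_q(f)`: number of units in `F_q[x]/⟨f⟩`. -/
def PhiPoly {F : Type*} [Field F] (f : F[X]) : ℕ := Nat.card (F[X] ⧸ Ideal.span {f})ˣ


section charsum
open Finset

theorem aux_norm_gauss {K : Type} [Field K] [Fintype K] {χ : MulChar K ℂ} (hχ : χ ≠ 1)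
    {ψ : AddChar K ℂ} (hψ : ψ.IsPrimitive) : ‖gaussSum χ ψ‖ ^ 2 = Fintype.card K := by
  have h := gaussSum_mul_gaussSum_eq_card hχ hψ
  rw [← star_gaussSum_eq, RCLike.star_def, Complex.mul_conj, Complex.normSq_eq_norm_sq] at h
  exact_mod_cast h

theorem aux_exists_prim (K : Type) [Field K] [Fintype K] :
    ∃ ψ : AddChar K ℂ, ψ.IsPrimitive := by
  obtain ⟨ψ, hψ⟩ : ∃ ψ : AddChar K ℂ, ψ ≠ 1 := by
    obtain ⟨ψ, h⟩ := AddChar.exists_apply_ne_zero.2 (one_ne_zero : (1:K) ≠ 0)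
    exact ⟨ψ, fun h' => h (by simp [h'])⟩
  exact ⟨ψ, AddChar.IsPrimitive.of_ne_one hψ⟩

theorem aux_norm_char {K : Type} [Field K] [Fintype K] (χ : MulChar K ℂ) (x : K) : ‖χ x‖ ≤ 1 := by
  classical
  by_cases hx : IsUnit x
  · obtain ⟨u, rfl⟩ := hx
    have := χ.apply_mem_rootsOfUnity u
    rw [← MulChar.coe_equivToUnitHom]
    exact (Complex.norm_eq_one_of_mem_rootsOfUnity this).le
  · simp [χ.map_nonunit hx]

theorem aux_subgroup_sum {K : Type} [Field K] [Fintype K] [DecidableEq K] (χ : MulChar K ℂ)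
    (hχ : χ ≠ 1) (V : AddSubgroup K) [DecidablePred (· ∈ V)] :
    ‖∑ x ∈ univ.filter (· ∈ V), χ x‖ * √(Fintype.card K) ≤
      (Fintype.card K : ℝ) - (#(univ.filter (· ∈ V)) : ℝ) := by
  classical
  obtain ⟨ψ, hψ⟩ := aux_exists_prim K
  set G := gaussSum χ⁻¹ ψ with hG
  have hGn : ‖G‖ = √(Fintype.card K) := by
    rw [← aux_norm_gauss (inv_ne_one.2 hχ) hψ, Real.sqrt_sq (norm_nonneg _)]
  set VF := univ.filter (· ∈ V) with hVF
  -- inner sums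
  have hinner : ∀ a : K, (∑ x ∈ VF, ψ (a * x) = (#VF : ℂ)) ∨ (∑ x ∈ VF, ψ (a * x) = 0) := by
    intro a
    by_cases h : ∀ x ∈ V, ψ (a * x) = 1
    · left
      rw [Finset.sum_congr rfl (g := fun _ => (1:ℂ))]
      · simp
      · intro x hx
        exact h x (by simpa [hVF] using hx)
    · right
      push Not at h
      obtain ⟨y, hy, hy1⟩ := h
      have : ψ (a * y) * ∑ x ∈ VF, ψ (a * x) = ∑ x ∈ VF, ψ (a * x) := by
        rw [Finset.mul_sum]
        refine Finset.sum_bij (fun x _ => y + x) ?_ ?_ ?_ ?_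
        · intro x hx
          simp only [hVF, mem_filter, mem_univ, true_and] at hx ⊢
          exact V.add_mem hy hx
        · intro x _ x' _ h
          exact add_left_cancel h
        · intro x hx
          simp only [hVF, mem_filter, mem_univ, true_and] at hx ⊢
          exact ⟨x - y, V.sub_mem hx hy, by ring⟩
        · intro x _
          rw [mul_add, AddChar.map_add_eq_mul]
      have h2 : (ψ (a * y) - 1) * ∑ x ∈ VF, ψ (a * x) = 0 := by
        rw [sub_mul, this]; ring
      rcases mul_eq_zero.1 h2 with h | h
      · exact absurd (sub_eq_zero.1 h) hy1
      · exact h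
  have hre : ∀ a : K, ∑ x ∈ VF, ψ (a * x) = ((‖∑ x ∈ VF, ψ (a * x)‖ : ℝ) : ℂ) := by
    intro a
    rcases hinner a with h | h <;> rw [h] <;> simp
  have htot : ∑ a : K, ∑ x ∈ VF, ψ (a * x) = (Fintype.card K : ℂ) := by
    rw [Finset.sum_comm]
    have : ∀ x : K, ∑ a : K, ψ (a * x) = if x = 0 then (Fintype.card K : ℂ) else 0 := by
      intro x
      rw [AddChar.sum_mulShift x hψ]; push_cast; rfl
    simp_rw [this]
    rw [Finset.sum_ite_eq']
    simp [hVF, V.zero_mem]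
  have htot' : ∑ a : K, ‖∑ x ∈ VF, ψ (a * x)‖ = (Fintype.card K : ℝ) := by
    have : ∑ a : K, ((‖∑ x ∈ VF, ψ (a * x)‖ : ℝ) : ℂ) = (Fintype.card K : ℂ) := by
      rw [← htot]
      exact Finset.sum_congr rfl (fun a _ => (hre a).symm)
    exact_mod_cast this
  have hmain : (∑ x ∈ VF, χ x) * G = ∑ a : K, χ⁻¹ a * ∑ x ∈ VF, ψ (a * x) := by
    have h1 : ∀ x : K, χ x * G = ∑ a : K, χ⁻¹ a * ψ (a * x) := by
      intro x
      by_cases hx : x = 0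
      · subst hx
        simp only [mul_zero, AddChar.map_zero_eq_one, mul_one]
        rw [MulChar.sum_eq_zero_of_ne_one (inv_ne_one.2 hχ), χ.map_nonunit not_isUnit_zero, zero_mul]
      · have := gaussSum_mulShift_eq χ⁻¹ ψ (Units.mk0 x hx)
        rw [inv_inv] at this
        simp only [Units.val_mk0] at this
        rw [hG, ← this, gaussSum]
        simp only [AddChar.mulShift_apply, mul_comm x]
    rw [Finset.sum_mul]
    simp_rw [h1]
    rw [Finset.sum_comm]
    simp_rw [Finset.mul_sum]
  rw [← hGn, ← norm_mul, hmain]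
  have hzero : ‖∑ x ∈ VF, ψ (0 * x)‖ = (#VF : ℝ) := by simp
  rw [← htot', ← hzero, ← Finset.add_sum_erase _ _ (mem_univ (0:K)),
    ← Finset.add_sum_erase (a := (0:K)) univ (fun a => ‖∑ x ∈ VF, ψ (a * x)‖) (mem_univ (0:K))]
  simp only [MulChar.map_zero, zero_mul, zero_add, add_sub_cancel_left]
  refine (norm_sum_le _ _).trans (Finset.sum_le_sum fun a _ => ?_)
  rw [norm_mul]
  exact mul_le_of_le_one_left (norm_nonneg _) (aux_norm_char _ _)

/-- abstract sieve step -/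
theorem aux_sieve_step {K : Type} [Field K] [Fintype K] (S : Finset K) (B : ℝ)
    (hB : ∀ χ : MulChar K ℂ, χ ≠ 1 → ‖∑ x ∈ S, χ x‖ ≤ B) (χ : ℕ → MulChar K ℂ)
    (U : Finset ℕ) (hU : ∀ l ∈ U, l.Prime ∧ orderOf (χ l) = l) :
    ∀ (η : MulChar K ℂ) (m : ℕ), η ^ m = 1 → (∀ l ∈ U, Nat.Coprime m l) → (η ≠ 1 ∨ U.Nonempty) →
    ‖∑ x ∈ S, η x * ∏ l ∈ U, (-(1 / ((l : ℂ) - 1)) * ∑ j ∈ Finset.Ico 1 l, χ l x ^ j)‖ ≤ B := by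
  induction U using Finset.induction_on with
  | empty =>
    intro η m _ _ h
    simp at h
    simpa using hB η h
  | insert l U hl ih =>
    intro η m hm hcop _
    have hlp : l.Prime := (hU l (by simp)).1
    have hlo := (hU l (by simp)).2
    have h1 : (1:ℝ) < l := by exact_mod_cast hlp.one_lt
    have heq : ∑ x ∈ S, η x * ∏ l ∈ insert l U,
        (-(1 / ((l : ℂ) - 1)) * ∑ j ∈ Finset.Ico 1 l, χ l x ^ j) =
        ∑ j ∈ Finset.Ico 1 l, (-(1 / ((l : ℂ) - 1))) * ∑ x ∈ S, (η * χ l ^ j) x * ∏ l ∈ U,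
        (-(1 / ((l : ℂ) - 1)) * ∑ j ∈ Finset.Ico 1 l, χ l x ^ j) := by
      simp_rw [Finset.mul_sum]
      rw [Finset.sum_comm]
      refine Finset.sum_congr rfl fun x _ => ?_
      rw [Finset.prod_insert hl, Finset.sum_mul, Finset.mul_sum]
      refine Finset.sum_congr rfl fun j hj => ?_
      rw [MulChar.mul_apply, MulChar.pow_apply' _ (by have := (Finset.mem_Ico.1 hj).1; omega)]
      ring
    rw [heq]
    have hn : ‖(-(1 / ((l : ℂ) - 1)))‖ = 1 / ((l:ℝ) - 1) := by
      rw [norm_neg, norm_div, norm_one]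
      congr 1
      have : ((l:ℂ) - 1) = (((l:ℝ) - 1 : ℝ) : ℂ) := by push_cast; rfl
      rw [this, Complex.norm_real, Real.norm_of_nonneg (by linarith)]
    refine (norm_sum_le _ _).trans ?_
    have : ∀ j ∈ Finset.Ico 1 l, ‖(-(1 / ((l : ℂ) - 1))) * ∑ x ∈ S, (η * χ l ^ j) x * ∏ l ∈ U,
        (-(1 / ((l : ℂ) - 1)) * ∑ j ∈ Finset.Ico 1 l, χ l x ^ j)‖ ≤ 1 / ((l:ℝ) - 1) * B := by
      intro j hj
      rw [norm_mul, hn]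
      refine mul_le_mul_of_nonneg_left ?_ (by apply one_div_nonneg.2; linarith)
      refine ih (fun l' hl' => hU l' (by simp [hl'])) _ (m * l) ?_ ?_ (Or.inl ?_)
      · have h2 : χ l ^ l = 1 := by
          conv_lhs => rw [← hlo]
          rw [hlo]; conv_lhs => rw [← hlo]
          rw [hlo]; exact orderOf_dvd_iff_pow_eq_one.1 hlo.dvd
        calc (η * χ l ^ j) ^ (m * l) = (η ^ m) ^ l * ((χ l) ^ l) ^ (j * m) := by
              rw [mul_pow, ← pow_mul, ← pow_mul, ← pow_mul]; congr 2; ring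
          _ = 1 := by rw [hm, h2]; simp
      · intro l' hl'
        refine Nat.Coprime.mul_left (hcop l' (by simp [hl'])) ?_
        rw [Nat.coprime_primes hlp (hU l' (by simp [hl'])).1]
        rintro rfl
        exact hl hl'
      · intro h
        have h3 : χ l ^ (j * m) = 1 := by
          have : (η * χ l ^ j) ^ m = 1 := by rw [h, one_pow]
          rwa [mul_pow, hm, one_mul, ← pow_mul] at this
        have h4 := orderOf_dvd_of_pow_eq_one h3
        rw [hlo] at h4
        rcases hlp.dvd_mul.1 h4 with h5 | h5
        · have := Finset.mem_Ico.1 hj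
          exact absurd (Nat.le_of_dvd (by omega) h5) (by omega)
        · have := hcop l (by simp)
          have h6 : l ∣ 1 := by
            rw [← this]; exact Nat.dvd_gcd h5 dvd_rfl
          exact hlp.one_lt.ne' (Nat.dvd_one.1 h6)
    refine (Finset.sum_le_sum this).trans ?_
    rw [Finset.sum_const, Nat.card_Ico, nsmul_eq_mul, Nat.cast_sub hlp.one_lt.le]
    have : (l:ℝ) - 1 ≠ 0 := by linarith
    apply le_of_eq
    field_simp
    push_cast; ring

theorem aux_sieve {K : Type} [Field K] [Fintype K] (S : Finset K) (B : ℝ)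
    (hB : ∀ χ : MulChar K ℂ, χ ≠ 1 → ‖∑ x ∈ S, χ x‖ ≤ B) (T : Finset ℕ)
    (hT : ∀ l ∈ T, l.Prime ∧ l ∣ Fintype.card K - 1) (h0 : (0:K) ∉ S)
    (hS : ((2:ℝ) ^ (#T) - 1) * B < #S) :
    ∃ x ∈ S, ∀ l ∈ T, ∀ y : K, y ^ l ≠ x := by
  classical
  have hch : ∀ l : ℕ, ∃ χ : MulChar K ℂ, l ∈ T → orderOf χ = l := by
    intro l
    by_cases hl : l ∈ T
    · obtain ⟨χ, h⟩ := MulChar.exists_mulChar_orderOf (R := ℂ) K (hT l hl).2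
        (Complex.isPrimitiveRoot_exp l (hT l hl).1.ne_zero)
      exact ⟨χ, fun _ => h⟩
    · exact ⟨1, fun h => absurd h hl⟩
  choose χ hχ using hch
  let g : ℕ → K → ℂ := fun l x => -(1 / ((l : ℂ) - 1)) * ∑ j ∈ Finset.Ico 1 l, χ l x ^ j
  by_contra hcon
  push Not at hcon
  have hz : ∑ x ∈ S, ∏ l ∈ T, (1 + g l x) = 0 := by
    refine Finset.sum_eq_zero fun x hx => ?_
    obtain ⟨l, hl, y, hy⟩ := hcon x hx
    refine Finset.prod_eq_zero hl ?_
    have hlp := (hT l hl).1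
    have hx0 : x ≠ 0 := fun h => h0 (h ▸ hx)
    have hy0 : y ≠ 0 := fun h => hx0 (by rw [← hy, h, zero_pow hlp.ne_zero])
    have h1 : χ l x = 1 := by
      rw [← hy, map_pow, ← MulChar.pow_apply' _ hlp.ne_zero,
        orderOf_dvd_iff_pow_eq_one.1 (hχ l hl).dvd, MulChar.one_apply (Ne.isUnit hy0)]
    simp only [g, h1, one_pow, sum_const, Nat.card_Ico, nsmul_eq_mul, mul_one]
    rw [Nat.cast_sub hlp.one_lt.le]
    have : (l:ℂ) - 1 ≠ 0 := by
      rw [sub_ne_zero]; exact_mod_cast hlp.one_lt.ne'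
    field_simp
    push_cast; ring
  have hexp : ∑ x ∈ S, ∏ l ∈ T, (1 + g l x) = ∑ U ∈ T.powerset, ∑ x ∈ S, ∏ l ∈ U, g l x := by
    rw [Finset.sum_comm]
    exact Finset.sum_congr rfl fun x _ => Finset.prod_one_add _
  rw [hexp, ← Finset.add_sum_erase _ _ (Finset.empty_mem_powerset T)] at hz
  simp only [prod_empty, sum_const, nsmul_eq_mul, mul_one] at hz
  have hb : ‖∑ U ∈ T.powerset.erase ∅, ∑ x ∈ S, ∏ l ∈ U, g l x‖ ≤ ((2:ℝ) ^ (#T) - 1) * B := by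
    refine (norm_sum_le _ _).trans ?_
    have : ∀ U ∈ T.powerset.erase ∅, ‖∑ x ∈ S, ∏ l ∈ U, g l x‖ ≤ B := by
      intro U hU
      have hU1 := Finset.mem_powerset.1 (Finset.mem_of_mem_erase hU)
      have hU2 := Finset.ne_of_mem_erase hU
      have := aux_sieve_step S B hB χ U (fun l hl => ⟨(hT l (hU1 hl)).1, hχ l (hU1 hl)⟩) 1 1
        (by simp) (by simp) (Or.inr (Finset.nonempty_iff_ne_empty.2 hU2))
      refine le_trans (le_of_eq ?_) this
      congr 1
      refine Finset.sum_congr rfl fun x hx => ?_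
      rw [MulChar.one_apply (Ne.isUnit (fun h => h0 (h ▸ hx))), one_mul]
    refine (Finset.sum_le_sum this).trans ?_
    rw [Finset.sum_const, Finset.card_erase_of_mem (Finset.empty_mem_powerset T),
      Finset.card_powerset, nsmul_eq_mul, Nat.cast_sub Nat.one_le_two_pow]
    push_cast
    exact le_rfl
  have : ‖(#S : ℂ)‖ = ‖∑ U ∈ T.powerset.erase ∅, ∑ x ∈ S, ∏ l ∈ U, g l x‖ := by
    rw [eq_neg_of_add_eq_zero_left hz, norm_neg]
  rw [Complex.norm_natCast] at this
  linarith

theorem aux_fixed {F K : Type} [Field F] [Fintype F] [Field K] [Fintype K] [Algebra F K]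
    (z : K) (hz : z ^ (Fintype.card F) = z) : ∃ c : F, algebraMap F K c = z := by
  classical
  have hne : (X ^ Fintype.card F - X : K[X]) ≠ 0 :=
    FiniteField.X_pow_card_sub_X_ne_zero K Fintype.one_lt_card
  have h1 : (univ.image (algebraMap F K)) = (X ^ Fintype.card F - X : K[X]).roots.toFinset := by
    apply Finset.eq_of_subset_of_card_le
    · intro w hw
      obtain ⟨c, _, rfl⟩ := Finset.mem_image.1 hw
      rw [Multiset.mem_toFinset, mem_roots hne]
      simp [← map_pow, FiniteField.pow_card]
    · rw [Finset.card_image_of_injective _ (algebraMap F K).injective, Finset.card_univ]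
      refine (Multiset.toFinset_card_le _).trans ((card_roots' _).trans ?_)
      rw [FiniteField.X_pow_card_sub_X_natDegree_eq K Fintype.one_lt_card]
  have : z ∈ (univ.image (algebraMap F K)) := by
    rw [h1, Multiset.mem_toFinset, mem_roots hne]
    simp [hz]
  obtain ⟨c, _, h⟩ := Finset.mem_image.1 this
  exact ⟨c, h⟩

/-- Lifting from `Q`-free to primitive by scaling. -/
theorem aux_primitive {F K : Type} [Field F] [Fintype F] [Field K] [Fintype K] [Algebra F K]
    (S : Finset K) (B : ℝ)
    (hB : ∀ χ : MulChar K ℂ, χ ≠ 1 → ‖∑ x ∈ S, χ x‖ ≤ B) (Q : ℕ)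
    (hQ : Fintype.card K - 1 = Q * (Fintype.card F - 1)) (h0 : (0:K) ∉ S)
    (hsc : ∀ c : F, c ≠ 0 → ∀ x ∈ S, algebraMap F K c * x ∈ S)
    (hS : ((2:ℝ) ^ (#Q.primeFactors) - 1) * B < #S) :
    ∃ x ∈ S, ∀ b : K, b ≠ 0 → ∃ m : ℕ, x ^ m = b := by
  classical
  obtain ⟨x, hxS, hx⟩ := aux_sieve S B hB Q.primeFactors (fun l hl =>
    ⟨Nat.prime_of_mem_primeFactors hl,
      hQ ▸ (Nat.dvd_of_mem_primeFactors hl).mul_right _⟩) h0 hS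
  have hx0 : x ≠ 0 := fun h => h0 (h ▸ hxS)
  obtain ⟨g, hg⟩ := IsCyclic.exists_generator (α := Kˣ)
  have hgo : orderOf g = Fintype.card K - 1 := by
    rw [orderOf_eq_card_of_forall_mem_zpowers hg, Nat.card_eq_fintype_card, Fintype.card_units]
  set M := Fintype.card K - 1 with hM
  have hMpos : 0 < M := by
    have := Fintype.one_lt_card (α := K); omega
  have hQpos : 0 < Q := by
    rcases Nat.eq_zero_or_pos Q with h | h
    · rw [h] at hQ; omega
    · exact h
  obtain ⟨k, hk⟩ : ∃ k : ℕ, g ^ k = Units.mk0 x hx0 := by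
    have := hg (Units.mk0 x hx0)
    rw [← mem_powers_iff_mem_zpowers] at this
    exact this
  have hkQ : Nat.Coprime k Q := by
    rw [Nat.coprime_iff_gcd_eq_one]
    by_contra hne
    obtain ⟨l, hl, hld⟩ := Nat.exists_prime_and_dvd hne
    have h1 : l ∣ k := hld.trans (Nat.gcd_dvd_left _ _)
    have h2 : l ∣ Q := hld.trans (Nat.gcd_dvd_right _ _)
    obtain ⟨t, ht⟩ := h1
    refine hx l (Nat.mem_primeFactors.2 ⟨hl, h2, hQpos.ne'⟩) ((g ^ t : Kˣ) : K) ?_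
    have := congrArg (Units.val) hk
    rw [Units.val_mk0] at this
    rw [← this, ht, ← Units.val_pow_eq_pow_val, ← pow_mul, mul_comm]
  have : NeZero M := ⟨hMpos.ne'⟩
  have : NeZero Q := ⟨hQpos.ne'⟩
  have hdvd : Q ∣ M := ⟨_, hQ⟩
  obtain ⟨u, hu⟩ := ZMod.unitsMap_surjective hdvd (ZMod.unitOfCoprime k hkQ)
  set k' := (u : ZMod M).val with hk'
  have hk'c : Nat.Coprime k' M := ZMod.val_coe_unit_coprime u
  have hmod : k' ≡ k [MOD Q] := by
    rw [← ZMod.natCast_eq_natCast_iff]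
    have := congrArg Units.val hu
    rw [ZMod.unitsMap_val, ZMod.coe_unitOfCoprime] at this
    rw [← this, hk']
    rw [ZMod.natCast_val]
  -- the scaled element
  have hF : ∀ z : K, z ^ (Fintype.card F) = z → ∃ c : F, algebraMap F K c = z := by
    intro z hz
    exact aux_fixed z hz
  set y : K := ((g ^ k' : Kˣ) : K) with hy
  have hcF : ((y / x)) ^ (Fintype.card F - 1) = 1 := by
    have hxk : x = ((g ^ k : Kˣ) : K) := by rw [hk]; simp
    have h1 : (g ^ k') ^ (Fintype.card F - 1) = (g ^ k) ^ (Fintype.card F - 1) := by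
      rw [← pow_mul, ← pow_mul, pow_eq_pow_iff_modEq, hgo, hQ]
      exact Nat.ModEq.mul_right' _ hmod
    rw [div_pow, hy, hxk, ← Units.val_pow_eq_pow_val, ← Units.val_pow_eq_pow_val, h1]
    exact div_self (Units.ne_zero _)
  obtain ⟨c, hc⟩ := hF (y / x) (by
    have : Fintype.card F = (Fintype.card F - 1) + 1 := by
      have := Fintype.one_lt_card (α := F); omega
    rw [this, pow_succ, hcF, one_mul])
  have hyx : algebraMap F K c * x = y := by rw [hc]; field_simp
  refine ⟨y, hyx ▸ hsc c ?_ x hxS, ?_⟩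
  · rintro rfl
    rw [map_zero, zero_mul] at hyx
    exact (Units.ne_zero (g ^ k')) hyx.symm
  · intro b hb
    have hgen : ∀ z : Kˣ, z ∈ Subgroup.zpowers (g ^ k') := by
      intro z
      have : Subgroup.zpowers (g ^ k') = ⊤ := by
        rw [← (Subgroup.eq_top_iff' _).2 hg]
        apply Subgroup.eq_of_le_of_card_ge
        · rw [Subgroup.zpowers_le]; exact Subgroup.pow_mem _ (Subgroup.mem_zpowers g) _
        · rw [Nat.card_zpowers, Nat.card_zpowers, (Nat.Coprime.symm (hgo ▸ hk'c)).orderOf_pow]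
      rw [this]; trivial
    have := hgen (Units.mk0 b hb)
    rw [← mem_powers_iff_mem_zpowers] at this
    obtain ⟨m, hm⟩ := this
    refine ⟨m, ?_⟩
    have := congrArg Units.val hm
    simpa [hy] using this

end charsum

section lin

/-- the Frobenius as a linear endomorphism -/
def sg (F K : Type) [Field F] [Fintype F] [Field K] [Algebra F K] : Module.End F K :=
  (FiniteField.frobeniusAlgHom F K).toLinearMap

theorem sg_pow (F K : Type) [Field F] [Fintype F] [Field K] [Algebra F K] (i : ℕ) (x : K) :
    (sg F K ^ i) x = x ^ (Fintype.card F) ^ i := by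
  induction i generalizing x with
  | zero => simp
  | succ i ih =>
    rw [pow_succ, Module.End.mul_apply, ih]
    simp only [sg, AlgHom.toLinearMap_apply, FiniteField.coe_frobeniusAlgHom]
    rw [← pow_mul, pow_succ, mul_comm]

/-- `h(a,b) = (X-1)^a (X+1)^b` -/
def hp (F : Type) [Field F] (a b : ℕ) : F[X] := (X - C 1) ^ a * (X + C 1) ^ b

theorem hp_monic (F : Type) [Field F] (a b : ℕ) : (hp F a b).Monic :=
  ((monic_X_sub_C 1).pow a).mul ((monic_X_add_C 1).pow b)

theorem hp_natDegree (F : Type) [Field F] (a b : ℕ) : (hp F a b).natDegree = a + b := by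
  rw [hp, Monic.natDegree_mul ((monic_X_sub_C 1).pow a) ((monic_X_add_C 1).pow b),
    (monic_X_sub_C 1).natDegree_pow, (monic_X_add_C 1).natDegree_pow,
    natDegree_X_sub_C, natDegree_X_add_C]
  ring

theorem aux_kill {F K : Type} [Field F] [Fintype F] [Field K] [Algebra F K] (a b : ℕ) (α : K)
    (h0 : aeval (sg F K) (hp F a b) α = 0)
    (h1 : 0 < a → aeval (sg F K) (hp F (a - 1) b) α ≠ 0)
    (h2 : 0 < b → aeval (sg F K) (hp F a (b - 1)) α ≠ 0) (g : F[X])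
    (hg : aeval (sg F K) g α = 0) : hp F a b ∣ g := by
  classical
  obtain ⟨u, v, huv⟩ : ∃ u v, EuclideanDomain.gcd g (hp F a b) = g * u + hp F a b * v :=
    ⟨_, _, EuclideanDomain.gcd_eq_gcd_ab _ _⟩
  set d := EuclideanDomain.gcd g (hp F a b) with hd
  have hdk : aeval (sg F K) d α = 0 := by
    rw [huv, mul_comm g, mul_comm (hp F a b)]
    simp only [map_add, map_mul, LinearMap.add_apply, Module.End.mul_apply, hg, h0, map_zero,
      add_zero]
  have hdk' : ∀ w, d ∣ w → aeval (sg F K) w α = 0 := by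
    rintro w ⟨t, rfl⟩
    rw [mul_comm]
    simp only [map_mul, Module.End.mul_apply, hdk, map_zero]
  obtain ⟨e, he⟩ : d ∣ hp F a b := EuclideanDomain.gcd_dvd_right _ _
  by_cases heu : IsUnit e
  · have : hp F a b ∣ d := by
      rw [he]
      exact (associated_mul_unit_left d e heu).dvd
    exact this.trans (EuclideanDomain.gcd_dvd_left _ _)
  · exfalso
    have hne : hp F a b ≠ 0 := (hp_monic F a b).ne_zero
    have he0 : e ≠ 0 := by
      rintro rfl; simp at he; exact hne he
    obtain ⟨π, hπ, hπe⟩ := WfDvdMonoid.exists_irreducible_factor heu he0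
    have hπp : Prime π := hπ.prime
    have hπh : π ∣ hp F a b := he ▸ hπe.mul_left d
    rcases hπp.dvd_or_dvd hπh with h | h
    · have ha : 0 < a := by
        rcases Nat.eq_zero_or_pos a with h' | h'
        · subst h'; rw [pow_zero] at h; exact absurd (isUnit_of_dvd_one h) hπ.not_isUnit
        · exact h'
      have h3 := hπp.dvd_of_dvd_pow h
      have h4 : (X - C 1 : F[X]) ∣ e :=
        ((hπ.associated_of_dvd (irreducible_X_sub_C 1) h3).symm.dvd).trans hπe
      obtain ⟨t, ht⟩ := h4
      apply h1 ha
      apply hdk'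
      refine ⟨t, mul_left_cancel₀ (X_sub_C_ne_zero (1:F)) ?_⟩
      calc (X - C 1) * hp F (a - 1) b = hp F a b := by
            rw [hp, hp, ← mul_assoc, ← pow_succ', Nat.sub_add_cancel ha]
        _ = _ := by rw [he, ht]; ring
    · have hb : 0 < b := by
        rcases Nat.eq_zero_or_pos b with h' | h'
        · subst h'; rw [pow_zero] at h; exact absurd (isUnit_of_dvd_one h) hπ.not_isUnit
        · exact h'
      have h3 := hπp.dvd_of_dvd_pow h
      have hirr : Irreducible (X + C 1 : F[X]) := by
        have := irreducible_X_sub_C (-1 : F)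
        rwa [C_neg, sub_neg_eq_add] at this
      have h4 : (X + C 1 : F[X]) ∣ e :=
        ((hπ.associated_of_dvd hirr h3).symm.dvd).trans hπe
      obtain ⟨t, ht⟩ := h4
      apply h2 hb
      apply hdk'
      refine ⟨t, mul_left_cancel₀ hirr.ne_zero ?_⟩
      calc (X + C 1) * hp F a (b - 1) = hp F a b := by
            rw [hp, hp]
            conv_rhs => rw [← Nat.sub_add_cancel hb, pow_succ]
            ring
        _ = _ := by rw [he, ht]; ring

theorem aux_normal {F K : Type} [Field F] [Fintype F] [Field K] [Fintype K] [Algebra F K]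
    (a b : ℕ) (α : K)
    (h0 : aeval (sg F K) (hp F a b) α = 0)
    (h1 : 0 < a → aeval (sg F K) (hp F (a - 1) b) α ≠ 0)
    (h2 : 0 < b → aeval (sg F K) (hp F a (b - 1)) α ≠ 0) :
    IskNormal (Fintype.card F) (a + b + 1) 1 F α := by
  classical
  unfold IskNormal
  rw [Nat.add_sub_cancel]
  have hk := aux_kill a b α h0 h1 h2
  have hdeg : (hp F a b).degree = ((a + b : ℕ) : WithBot ℕ) := by
    rw [degree_eq_natDegree (hp_monic F a b).ne_zero, hp_natDegree]
  have hli : LinearIndependent F (fun i : Fin (a + b) => α ^ (Fintype.card F) ^ (i : ℕ)) := by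
    rw [Fintype.linearIndependent_iff]
    intro c hc
    set g : F[X] := ∑ i : Fin (a + b), C (c i) * X ^ (i : ℕ) with hg
    have hgα : aeval (sg F K) g α = 0 := by
      rw [hg, map_sum, LinearMap.sum_apply, ← hc]
      refine Finset.sum_congr rfl fun i _ => ?_
      rw [map_mul, aeval_C, map_pow, aeval_X, Module.End.mul_apply, Module.algebraMap_end_apply,
        sg_pow]
    have hgd : g.degree < ((a + b : ℕ) : WithBot ℕ) := degree_sum_fin_lt c
    have hg0 : g = 0 := by
      apply eq_zero_of_dvd_of_degree_lt (hk g hgα)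
      rw [hdeg]; exact hgd
    intro i
    have := congrArg (fun w => coeff w (i : ℕ)) hg0
    simp only [hg, finsetSum_coeff, coeff_C_mul, coeff_X_pow, coeff_zero] at this
    rw [Finset.sum_eq_single i] at this
    · simpa using this
    · intro j _ hj
      rw [if_neg, mul_zero]
      intro h; exact hj (Fin.ext h.symm)
    · simp
  have hspan : Submodule.span F (Set.range fun i : Fin (a + b + 1) => α ^ (Fintype.card F) ^ (i : ℕ))
      = Submodule.span F (Set.range fun i : Fin (a + b) => α ^ (Fintype.card F) ^ (i : ℕ)) := by
    apply le_antisymm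
    · rw [Submodule.span_le]
      rintro _ ⟨i, rfl⟩
      rcases Nat.lt_succ_iff_lt_or_eq.1 i.2 with h | h
      · exact Submodule.subset_span ⟨⟨i, h⟩, rfl⟩
      · simp only [h]
        have hlt : (X ^ (a + b) - hp F a b).degree < ((a + b : ℕ) : WithBot ℕ) := by
          have := degree_sub_lt_left (p := (X ^ (a + b) : F[X])) (q := hp F a b)
            (by rw [hdeg, degree_X_pow]) (monic_X_pow _).ne_zero
            (by rw [(hp_monic F a b).leadingCoeff, (monic_X_pow _).leadingCoeff])
          rwa [degree_X_pow] at this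
        have hval : α ^ Fintype.card F ^ (a + b) = aeval (sg F K) (X ^ (a + b) - hp F a b) α := by
          rw [map_sub, LinearMap.sub_apply, h0, sub_zero, map_pow, aeval_X, sg_pow]
        set w := X ^ (a + b) - hp F a b with hw
        rw [SetLike.mem_coe, hval, as_sum_range' w (a + b + 1) (by
          by_cases hw0 : w = 0
          · rw [hw0]; simp
          · rw [natDegree_lt_iff_degree_lt hw0]
            exact hlt.trans (by exact_mod_cast Nat.lt_succ_self _)), map_sum, LinearMap.sum_apply]
        refine Submodule.sum_mem _ fun j hj => ?_
        rw [← C_mul_X_pow_eq_monomial, map_mul, aeval_C, map_pow, aeval_X, Module.End.mul_apply,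
          Module.algebraMap_end_apply, sg_pow]
        by_cases hjl : j < a + b
        · exact Submodule.smul_mem _ _ (Submodule.subset_span ⟨⟨j, hjl⟩, rfl⟩)
        · rw [coeff_eq_zero_of_degree_lt (hlt.trans_le (by exact_mod_cast not_lt.1 hjl)), zero_smul]
          exact Submodule.zero_mem _
    · apply Submodule.span_mono
      rintro _ ⟨i, rfl⟩
      exact ⟨⟨i, by omega⟩, rfl⟩
  rw [hspan, finrank_span_eq_card hli, Fintype.card_fin]

/-- kernels -/
def kr (F K : Type) [Field F] [Fintype F] [Field K] [Algebra F K] (a b : ℕ) : Submodule F K :=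
  LinearMap.ker (aeval (sg F K) (hp F a b))

theorem mem_kr {F K : Type} [Field F] [Fintype F] [Field K] [Algebra F K] {a b : ℕ} {x : K} :
    x ∈ kr F K a b ↔ aeval (sg F K) (hp F a b) x = 0 := LinearMap.mem_ker

theorem kr_mono {F K : Type} [Field F] [Fintype F] [Field K] [Algebra F K] {a b a' b' : ℕ}
    (ha : a ≤ a') (hb : b ≤ b') : kr F K a b ≤ kr F K a' b' := by
  intro x hx
  rw [mem_kr] at *
  have : hp F a' b' = hp F (a' - a) (b' - b) * hp F a b := by
    simp only [hp]
    conv_lhs => rw [← Nat.sub_add_cancel ha, ← Nat.sub_add_cancel hb]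
    rw [pow_add, pow_add]; ring
  rw [this, map_mul, Module.End.mul_apply, hx, map_zero]

theorem aux_finrank_ker_mul {F K : Type} [Field F] [AddCommGroup K] [Module F K]
    [FiniteDimensional F K] (A B : Module.End F K) :
    Module.finrank F (LinearMap.ker (A * B)) ≤
      Module.finrank F (LinearMap.ker A) + Module.finrank F (LinearMap.ker B) := by
  let f : LinearMap.ker (A * B) →ₗ[F] LinearMap.ker A :=
    (B.domRestrict (LinearMap.ker (A * B))).codRestrict _ (fun x => by
      have := x.2
      rw [LinearMap.mem_ker] at *
      exact this)
  have h := LinearMap.finrank_range_add_finrank_ker f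
  have h1 : Module.finrank F (LinearMap.range f) ≤ Module.finrank F (LinearMap.ker A) :=
    Submodule.finrank_le _
  have h2 : Module.finrank F (LinearMap.ker f) ≤ Module.finrank F (LinearMap.ker B) := by
    let k : LinearMap.ker f →ₗ[F] LinearMap.ker B :=
      ((LinearMap.ker (A * B)).subtype.domRestrict (LinearMap.ker f)).codRestrict _ (fun x => by
        have := x.2
        rw [LinearMap.mem_ker] at *
        have := congrArg Subtype.val this
        exact this)
    apply LinearMap.finrank_le_finrank_of_injective (f := k)
    intro x y hxy
    have := congrArg Subtype.val hxy
    exact Subtype.ext (Subtype.ext this)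
  omega

theorem aux_ker_one {F K : Type} [Field F] [Fintype F] [Field K] [Fintype K] [Algebra F K]
    (c : F) : Module.finrank F (LinearMap.ker (aeval (sg F K) (X - C c))) ≤ 1 := by
  classical
  set V := LinearMap.ker (aeval (sg F K) (X - C c)) with hV
  have hcard : Nat.card V ≤ Fintype.card F := by
    set P : K[X] := X ^ Fintype.card F - C (algebraMap F K c) * X with hP
    have hPd : P.natDegree = Fintype.card F := by
      rw [hP, natDegree_sub_eq_left_of_natDegree_lt]
      · simp
      · rw [natDegree_X_pow]
        refine (natDegree_C_mul_le _ _).trans_lt (natDegree_X_le.trans_lt Fintype.one_lt_card)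
    have hP0 : P ≠ 0 := by
      intro h; rw [h, natDegree_zero] at hPd
      exact Fintype.card_ne_zero hPd.symm
    have hsub : (V : Set K) ⊆ (P.roots.toFinset : Set K) := by
      intro x hx
      rw [SetLike.mem_coe, hV, LinearMap.mem_ker] at hx
      rw [map_sub, aeval_X, aeval_C, LinearMap.sub_apply, Module.algebraMap_end_apply] at hx
      have h1 := sg_pow F K 1 x
      rw [pow_one, pow_one] at h1
      rw [Finset.mem_coe, Multiset.mem_toFinset, mem_roots hP0]
      rw [h1, Algebra.smul_def] at hx
      simpa [hP] using hx
    calc Nat.card V = (V : Set K).ncard := rfl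
      _ ≤ (P.roots.toFinset : Set K).ncard := Set.ncard_le_ncard hsub (Finset.finite_toSet _)
      _ = P.roots.toFinset.card := Set.ncard_coe_finset _
      _ ≤ P.natDegree := (Multiset.toFinset_card_le _).trans (card_roots' _)
      _ = _ := hPd
  rw [Module.natCard_eq_pow_finrank (K := F), Nat.card_eq_fintype_card] at hcard
  by_contra h
  have h2 : (Fintype.card F) ^ 2 ≤ Fintype.card F :=
    (Nat.pow_le_pow_right Fintype.card_pos (by omega)).trans hcard
  have := Fintype.one_lt_card (α := F)
  nlinarith

theorem kr_finrank_le {F K : Type} [Field F] [Fintype F] [Field K] [Fintype K] [Algebra F K]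
    (a b : ℕ) : Module.finrank F (kr F K a b) ≤ a + b := by
  have hX : (X + C 1 : F[X]) = X - C (-1) := by rw [C_neg, sub_neg_eq_add]
  induction a with
  | zero =>
    induction b with
    | zero =>
      have : kr F K 0 0 = ⊥ := by
        rw [eq_bot_iff]; intro x hx; rw [mem_kr] at hx; simpa [hp] using hx
      rw [this]; simp
    | succ b ih =>
      have : kr F K 0 (b + 1) = LinearMap.ker (aeval (sg F K) (hp F 0 b) *
          aeval (sg F K) (X - C (-1) : F[X])) := by
        rw [← map_mul, ← hX, kr]; congr 2; simp only [hp]; ring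
      rw [this]
      refine (aux_finrank_ker_mul _ _).trans ?_
      have := aux_ker_one (F := F) (K := K) (-1)
      have h2 : Module.finrank F (LinearMap.ker (aeval (sg F K) (hp F 0 b))) ≤ 0 + b := ih
      omega
  | succ a ih =>
    have : kr F K (a + 1) b = LinearMap.ker (aeval (sg F K) (hp F a b) *
          aeval (sg F K) (X - C 1 : F[X])) := by
        rw [← map_mul, kr]; congr 2; simp only [hp]; ring
    rw [this]
    refine (aux_finrank_ker_mul _ _).trans ?_
    have := aux_ker_one (F := F) (K := K) 1
    have h2 : Module.finrank F (LinearMap.ker (aeval (sg F K) (hp F a b))) ≤ a + b := ih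
    omega

theorem kr_finrank_eq {F K : Type} [Field F] [Fintype F] [Field K] [Fintype K] [Algebra F K]
    (a b : ℕ) (hr : Module.finrank F K = a + b + 1)
    (hh : hp F (a + 1) b = X ^ (a + b + 1) - 1) : Module.finrank F (kr F K a b) = a + b := by
  apply le_antisymm (kr_finrank_le a b)
  have h1 := aux_ker_one (F := F) (K := K) 1
  have h2 := LinearMap.finrank_range_add_finrank_ker (aeval (sg F K) (X - C 1 : F[X]))
  have h3 : LinearMap.range (aeval (sg F K) (X - C 1 : F[X])) ≤ kr F K a b := by
    rintro _ ⟨x, rfl⟩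
    rw [mem_kr, ← Module.End.mul_apply, ← map_mul]
    have : hp F a b * (X - C 1) = X ^ (a + b + 1) - 1 := by
      rw [← hh]; simp only [hp]; ring
    rw [this, map_sub, map_pow, aeval_X, map_one, LinearMap.sub_apply, sg_pow, ← hr,
      ← Module.card_eq_pow_finrank, FiniteField.pow_card]
    simp
  have h4 := Submodule.finrank_mono h3
  omega

end lin

section comb
open Finset

theorem aux_card_sub {F K : Type} [Field F] [Fintype F] [Field K] [Fintype K] [Algebra F K]
    [DecidableEq K] (V : Submodule F K) [DecidablePred (· ∈ V)] :
    #(univ.filter (· ∈ V)) = Fintype.card F ^ Module.finrank F V := by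
  rw [← Module.card_eq_pow_finrank (K := F) (V := V), Fintype.card_subtype]

theorem aux_sub_sum {F K : Type} [Field F] [Fintype F] [Field K] [Fintype K] [Algebra F K]
    [DecidableEq K] (V : Submodule F K) [DecidablePred (· ∈ V)] (χ : MulChar K ℂ) (hχ : χ ≠ 1) :
    ‖∑ x ∈ univ.filter (· ∈ V), χ x‖ ≤ √(Fintype.card K) := by
  have h := aux_subgroup_sum χ hχ V.toAddSubgroup
  simp only [Submodule.mem_toAddSubgroup] at h
  have hpos : (0:ℝ) < Fintype.card K := by exact_mod_cast Fintype.card_pos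
  have h2 : ‖∑ x ∈ univ.filter (· ∈ V), χ x‖ * √(Fintype.card K) ≤
      √(Fintype.card K) * √(Fintype.card K) := by
    rw [Real.mul_self_sqrt hpos.le]
    refine h.trans ?_
    have : (0:ℝ) ≤ (#(univ.filter (· ∈ V)) : ℝ) := by positivity
    linarith
  exact le_of_mul_le_mul_right h2 (Real.sqrt_pos.2 hpos)

theorem aux_case1 {F K : Type} [Field F] [Fintype F] [Field K] [Fintype K] [Algebra F K]
    (a Q : ℕ) (ha : 0 < a) (hr : Module.finrank F K = a + 1)
    (hh : hp F (a + 1) 0 = X ^ (a + 1) - 1)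
    (hQ : Fintype.card F ^ (a + 1) - 1 = Q * (Fintype.card F - 1))
    (hnum : ((2:ℝ) ^ (#Q.primeFactors) - 1) * (2 * √((Fintype.card F : ℝ) ^ (a + 1))) <
      (Fintype.card F : ℝ) ^ a - (Fintype.card F : ℝ) ^ (a - 1)) :
    ∃ α : K, IsPrimitiveElt α ∧ IskNormal (Fintype.card F) (a + 1) 1 F α := by
  classical
  have hcK : Fintype.card K = Fintype.card F ^ (a + 1) := by
    rw [← hr, ← Module.card_eq_pow_finrank]
  set V1 := univ.filter (· ∈ kr F K a 0) with hV1
  set V2 := univ.filter (· ∈ kr F K (a - 1) 0) with hV2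
  have h21 : V2 ⊆ V1 := by
    intro x hx
    simp only [hV1, hV2, mem_filter, mem_univ, true_and] at *
    exact kr_mono (by omega) le_rfl hx
  have hc1 : #V1 = Fintype.card F ^ a := by
    rw [hV1, aux_card_sub, kr_finrank_eq a 0 (by simpa using hr) (by simpa using hh)]; rfl
  have hc2 : #V2 ≤ Fintype.card F ^ (a - 1) := by
    rw [hV2, aux_card_sub]
    exact Nat.pow_le_pow_right Fintype.card_pos (kr_finrank_le _ _)
  obtain ⟨α, hα, hprim⟩ := aux_primitive (F := F) (K := K) (V1 \ V2)
    (2 * √((Fintype.card F : ℝ) ^ (a + 1))) (by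
      intro χ hχ
      have e1 := aux_sub_sum (kr F K a 0) χ hχ
      have e2 := aux_sub_sum (kr F K (a - 1) 0) χ hχ
      rw [← hV1] at e1
      rw [← hV2] at e2
      have : ∑ x ∈ V1 \ V2, χ x = ∑ x ∈ V1, χ x - ∑ x ∈ V2, χ x := by
        rw [← Finset.sum_sdiff h21]; ring
      rw [this]
      refine (norm_sub_le _ _).trans ?_
      rw [hcK] at e1 e2
      push_cast at e1 e2
      linarith) Q (by rw [hcK, hQ]) (by
      simp only [mem_sdiff, not_and, not_not]
      intro _
      simp [hV2]) (by
      intro c hc x hx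
      simp only [hV1, hV2, mem_sdiff, mem_filter, mem_univ, true_and] at hx ⊢
      rw [← Algebra.smul_def]
      refine ⟨Submodule.smul_mem _ _ hx.1, fun h => hx.2 ?_⟩
      exact (Submodule.smul_mem_iff _ hc).1 h) (by
      refine hnum.trans_le ?_
      rw [Finset.card_sdiff_of_subset h21, Nat.cast_sub (Finset.card_le_card h21), hc1]
      have : (#V2 : ℝ) ≤ (Fintype.card F : ℝ) ^ (a - 1) := by exact_mod_cast hc2
      push_cast
      linarith)
  simp only [hV1, hV2, mem_sdiff, mem_filter, mem_univ, true_and] at hα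
  exact ⟨α, hprim, aux_normal a 0 α (mem_kr.1 hα.1) (fun _ h => hα.2 (mem_kr.2 h))
    (fun h => absurd h (lt_irrefl 0))⟩

theorem aux_case3 {F K : Type} [Field F] [Fintype F] [Field K] [Fintype K] [Algebra F K]
    (Q : ℕ) (hr : Module.finrank F K = 3)
    (hh : hp F 3 0 = X ^ 3 - 1)
    (hQ : Fintype.card F ^ 3 - 1 = Q * (Fintype.card F - 1))
    (hnum : ((2:ℝ) ^ (#Q.primeFactors) - 1) * √(Fintype.card F : ℝ) < (Fintype.card F : ℝ) + 1) :
    ∃ α : K, IsPrimitiveElt α ∧ IskNormal (Fintype.card F) 3 1 F α := by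
  classical
  have hcK : Fintype.card K = Fintype.card F ^ 3 := by
    rw [← hr, ← Module.card_eq_pow_finrank]
  have hq1 : 1 < Fintype.card F := Fintype.one_lt_card
  have hq1' : (1:ℝ) < Fintype.card F := by exact_mod_cast hq1
  set V1 := univ.filter (· ∈ kr F K 2 0) with hV1
  have hc1 : #V1 = Fintype.card F ^ 2 := by
    rw [hV1, aux_card_sub, kr_finrank_eq 2 0 (by simpa using hr) (by simpa using hh)]
  have h01 : (0:K) ∈ V1 := by simp [hV1]
  set s := √(Fintype.card F : ℝ) with hs
  have hs2 : s ^ 2 = Fintype.card F := Real.sq_sqrt (by linarith)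
  have hspos : 0 < s := Real.sqrt_pos.2 (by linarith)
  obtain ⟨α, hα, hprim⟩ := aux_primitive (F := F) (K := K) (V1.erase 0)
    (s * (Fintype.card F - 1)) (by
      intro χ hχ
      have e1 := aux_subgroup_sum χ hχ (kr F K 2 0).toAddSubgroup
      simp only [Submodule.mem_toAddSubgroup] at e1
      rw [← hV1, hc1, hcK] at e1
      have h3 : ∑ x ∈ V1.erase 0, χ x = ∑ x ∈ V1, χ x := by
        rw [← Finset.add_sum_erase _ _ h01, χ.map_nonunit not_isUnit_zero, zero_add]
      rw [h3]
      push_cast at e1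
      have hsq : √((Fintype.card F : ℝ) ^ 3) = s ^ 3 := by
        rw [← hs2, show (s ^ 2) ^ 3 = (s ^ 3) ^ 2 by ring, Real.sqrt_sq (by positivity)]
      rw [hsq] at e1
      refine le_of_mul_le_mul_right (e1.trans (le_of_eq ?_)) (show 0 < s ^ 3 by positivity)
      rw [← hs2]; ring) Q (by rw [hcK, hQ]) (by simp) (by
      intro c hc x hx
      simp only [hV1, mem_erase, mem_filter, mem_univ, true_and] at hx ⊢
      rw [← Algebra.smul_def]
      exact ⟨smul_ne_zero hc hx.1, Submodule.smul_mem _ _ hx.2⟩) (by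
      rw [Finset.card_erase_of_mem h01, hc1, Nat.cast_sub (Nat.one_le_pow _ _ (by omega))]
      push_cast
      nlinarith)
  simp only [hV1, mem_erase, mem_filter, mem_univ, true_and] at hα
  refine ⟨α, hprim, aux_normal 2 0 α (mem_kr.1 hα.2) (fun _ h => ?_)
    (fun h => absurd h (lt_irrefl 0))⟩
  have hall : (⊤ : Submodule F K) ≤ LinearMap.ker (aeval (sg F K) (X - C 1 : F[X])) := by
    intro b _
    have hfix : α ^ Fintype.card F = α := by
      have h1 := sg_pow F K 1 α
      rw [pow_one, pow_one] at h1
      simp only [hp, map_one] at h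
      simp [h1] at h
      exact sub_eq_zero.1 h
    have h1 := sg_pow F K 1 b
    rw [pow_one, pow_one] at h1
    rw [LinearMap.mem_ker, map_one, map_sub, aeval_X, map_one, LinearMap.sub_apply, h1, sub_eq_zero]
    simp only [Module.End.one_apply]
    by_cases hb : b = 0
    · rw [hb, zero_pow (by omega)]
    · obtain ⟨m, rfl⟩ := hprim b hb
      rw [← pow_mul, mul_comm, pow_mul, hfix]
  have h5 := Submodule.finrank_mono hall
  rw [finrank_top, hr] at h5
  have := aux_ker_one (F := F) (K := K) 1
  omega

theorem aux_case2 {F K : Type} [Field F] [Fintype F] [Field K] [Fintype K] [Algebra F K]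
    (a b m Q : ℕ) (ha : 0 < a) (hb : 0 < b) (hm : a + b + 1 = 2 * m)
    (hr : Module.finrank F K = a + b + 1)
    (hh : hp F (a + 1) b = X ^ (a + b + 1) - 1)
    (hQ : Fintype.card F ^ (a + b + 1) - 1 = Q * (Fintype.card F - 1))
    (hnum : ((2:ℝ) ^ (#Q.primeFactors) - 1) * (4 * (Fintype.card F : ℝ) ^ m) <
      (Fintype.card F : ℝ) ^ (a + b) - 2 * (Fintype.card F : ℝ) ^ (a + b - 1)) :
    ∃ α : K, IsPrimitiveElt α ∧ IskNormal (Fintype.card F) (a + b + 1) 1 F α := by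
  classical
  have hcK : Fintype.card K = Fintype.card F ^ (a + b + 1) := by
    rw [← hr, ← Module.card_eq_pow_finrank]
  have hsq : √(Fintype.card K : ℝ) = (Fintype.card F : ℝ) ^ m := by
    rw [hcK, hm]
    push_cast
    rw [mul_comm 2 m, pow_mul, Real.sqrt_sq (by positivity)]
  set V1 := univ.filter (· ∈ kr F K a b) with hV1
  set V2 := univ.filter (· ∈ kr F K (a - 1) b) with hV2
  set V3 := univ.filter (· ∈ kr F K a (b - 1)) with hV3
  set V4 := univ.filter (· ∈ kr F K (a - 1) b ⊓ kr F K a (b - 1)) with hV4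
  have hV4' : V4 = V2 ∩ V3 := by
    ext x; simp [hV2, hV3, hV4]
  have h21 : V2 ∪ V3 ⊆ V1 := by
    intro x hx
    simp only [hV1, hV2, hV3, mem_union, mem_filter, mem_univ, true_and] at *
    rcases hx with hx | hx
    · exact kr_mono (by omega) le_rfl hx
    · exact kr_mono le_rfl (by omega) hx
  have hc1 : #V1 = Fintype.card F ^ (a + b) := by
    rw [hV1, aux_card_sub, kr_finrank_eq a b hr hh]
  have hc2 : #V2 ≤ Fintype.card F ^ (a + b - 1) := by
    rw [hV2, aux_card_sub]
    exact Nat.pow_le_pow_right Fintype.card_pos ((kr_finrank_le _ _).trans (by omega))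
  have hc3 : #V3 ≤ Fintype.card F ^ (a + b - 1) := by
    rw [hV3, aux_card_sub]
    exact Nat.pow_le_pow_right Fintype.card_pos ((kr_finrank_le _ _).trans (by omega))
  obtain ⟨α, hα, hprim⟩ := aux_primitive (F := F) (K := K) (V1 \ (V2 ∪ V3))
    (4 * (Fintype.card F : ℝ) ^ m) (by
      intro χ hχ
      have e1 := aux_sub_sum (kr F K a b) χ hχ
      have e2 := aux_sub_sum (kr F K (a - 1) b) χ hχ
      have e3 := aux_sub_sum (kr F K a (b - 1)) χ hχ
      have e4 := aux_sub_sum (kr F K (a - 1) b ⊓ kr F K a (b - 1)) χ hχ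
      rw [← hV1] at e1
      rw [← hV2] at e2
      rw [← hV3] at e3
      rw [← hV4, hV4'] at e4
      have t1 := Finset.sum_sdiff (f := χ) h21
      have t2 := Finset.sum_union_inter (s₁ := V2) (s₂ := V3) (f := χ)
      have : ∑ x ∈ V1 \ (V2 ∪ V3), χ x = ∑ x ∈ V1, χ x - ∑ x ∈ V2, χ x - ∑ x ∈ V3, χ x
          + ∑ x ∈ V2 ∩ V3, χ x := by
        linear_combination t1 - t2
      rw [this]
      rw [hsq] at e1 e2 e3 e4
      have i1 := norm_add_le (∑ x ∈ V1, χ x - ∑ x ∈ V2, χ x - ∑ x ∈ V3, χ x) (∑ x ∈ V2 ∩ V3, χ x)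
      have i2 := norm_sub_le (∑ x ∈ V1, χ x - ∑ x ∈ V2, χ x) (∑ x ∈ V3, χ x)
      have i3 := norm_sub_le (∑ x ∈ V1, χ x) (∑ x ∈ V2, χ x)
      linarith) Q (by rw [hcK, hQ]) (by
      simp only [mem_sdiff, not_and, not_not]
      intro _
      simp [hV2]) (by
      intro c hc x hx
      simp only [hV1, hV2, hV3, mem_sdiff, mem_union, mem_filter, mem_univ, true_and] at hx ⊢
      rw [← Algebra.smul_def]
      refine ⟨Submodule.smul_mem _ _ hx.1, fun h => hx.2 ?_⟩
      rwa [Submodule.smul_mem_iff _ hc, Submodule.smul_mem_iff _ hc] at h) (by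
      refine hnum.trans_le ?_
      rw [Finset.card_sdiff_of_subset h21, Nat.cast_sub (Finset.card_le_card h21), hc1]
      have : (#(V2 ∪ V3) : ℝ) ≤ 2 * (Fintype.card F : ℝ) ^ (a + b - 1) := by
        have := Finset.card_union_le V2 V3
        have h5 : #(V2 ∪ V3) ≤ 2 * Fintype.card F ^ (a + b - 1) := by omega
        exact_mod_cast h5
      push_cast
      linarith)
  simp only [hV1, hV2, hV3, mem_sdiff, mem_union, mem_filter, mem_univ, true_and, not_or] at hα
  exact ⟨α, hprim, aux_normal a b α (mem_kr.1 hα.1) (fun _ h => hα.2.1 (mem_kr.2 h))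
    (fun _ h => hα.2.2 (mem_kr.2 h))⟩

end comb

section numerics
open Finset

theorem aux_omega (c Q : ℕ) (hQ : Q ≠ 0) (T : Finset ℕ) (hT : ∀ l ∈ T, l ≤ c)
    (hl : ∀ l : ℕ, l.Prime → l ∣ Q → l < c → l ∈ T) :
    c ^ (#Q.primeFactors) * ∏ l ∈ T, l ≤ c ^ (#T) * Q := by
  set P := Q.primeFactors with hP
  have h1 : c ^ (#(P \ T)) ≤ ∏ l ∈ P \ T, l := by
    apply Finset.pow_card_le_prod
    intro l hl'
    rw [mem_sdiff] at hl'
    by_contra h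
    exact hl'.2 (hl l (Nat.prime_of_mem_primeFactors hl'.1) (Nat.dvd_of_mem_primeFactors hl'.1)
      (not_le.1 h))
  have h2 : ∏ l ∈ T \ P, l ≤ c ^ (#(T \ P)) := by
    apply Finset.prod_le_pow_card
    intro l hl'
    exact hT l (mem_sdiff.1 hl').1
  have h3 : (∏ l ∈ P \ T, l) * ∏ l ∈ P ∩ T, l = ∏ l ∈ P, l := by
    rw [mul_comm]; exact Finset.prod_inter_mul_prod_sdiff P T _
  have h4 : (∏ l ∈ T \ P, l) * ∏ l ∈ P ∩ T, l = ∏ l ∈ T, l := by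
    rw [mul_comm, inter_comm]; exact Finset.prod_inter_mul_prod_sdiff T P _
  have h5 : #P = #(P \ T) + #(P ∩ T) := (Finset.card_sdiff_add_card_inter P T).symm
  have h6 : #T = #(T \ P) + #(P ∩ T) := by
    rw [inter_comm]; exact (Finset.card_sdiff_add_card_inter T P).symm
  have h7 : ∏ l ∈ P, l ≤ Q := Nat.le_of_dvd (Nat.pos_of_ne_zero hQ) (Nat.prod_primeFactors_dvd Q)
  rw [h5, ← h4, h6, pow_add, pow_add]
  calc c ^ #(P \ T) * c ^ #(P ∩ T) * ((∏ l ∈ T \ P, l) * ∏ l ∈ P ∩ T, l)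
      ≤ (∏ l ∈ P \ T, l) * c ^ #(P ∩ T) * (c ^ (#(T \ P)) * ∏ l ∈ P ∩ T, l) := by gcongr
    _ = c ^ (#(T \ P)) * c ^ #(P ∩ T) * ((∏ l ∈ P \ T, l) * ∏ l ∈ P ∩ T, l) := by ring
    _ ≤ _ := by rw [h3]; gcongr

/-- the quotient -/
def Qn (q n : ℕ) : ℕ := ∑ i ∈ range n, q ^ i

theorem Qn_mul (q n : ℕ) (hq : 1 ≤ q) : q ^ n - 1 = Qn q n * (q - 1) := by
  have : Qn q n * (q - 1) + 1 = q ^ n := by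
    obtain ⟨r, rfl⟩ : ∃ r, q = r + 1 := ⟨q - 1, by omega⟩
    simp only [Nat.add_sub_cancel]
    exact geom_sum_mul_add r n
  omega

theorem Qn_pos (q n : ℕ) (hn : 0 < n) : Qn q n ≠ 0 := by
  unfold Qn
  rw [Finset.range_eq_Ico, Finset.sum_eq_sum_Ico_succ_bot hn]
  simp

theorem Qn_lt (q n : ℕ) (hq : 1 ≤ q) : Qn q n * (q - 1) < q ^ n := by
  have := Qn_mul q n hq
  have h2 : 0 < q ^ n := Nat.pow_pos (by omega)
  omega

theorem Qn_not_dvd (p q n : ℕ) (hp : p.Prime) (hpq : p ∣ q) (hn : 0 < n) : ¬ p ∣ Qn q n := by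
  unfold Qn
  rw [Finset.range_eq_Ico, Finset.sum_eq_sum_Ico_succ_bot hn]
  intro h
  rw [pow_zero] at h
  have h2 : p ∣ ∑ k ∈ Ico (0 + 1) n, q ^ k := by
    apply Finset.dvd_sum
    intro i hi
    exact dvd_pow hpq (by have := (mem_Ico.1 hi).1; omega)
  exact hp.one_lt.ne' (Nat.dvd_one.1 ((Nat.dvd_add_left h2).1 h))

theorem Qn_prime (p q l : ℕ) (hp : p.Prime) (hodd : Odd p) (hpq : p ∣ q) (hqo : Odd q)
    (hl : l.Prime) (hlQ : l ∣ Qn q p) : 2 * p ∣ l - 1 := by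
  have : Fact l.Prime := ⟨hl⟩
  have hlp : l ≠ p := by
    rintro rfl
    exact Qn_not_dvd l q l hl hpq hl.pos hlQ
  have hQ0 : ((Qn q p : ℕ) : ZMod l) = 0 := (ZMod.natCast_eq_zero_iff _ _).2 hlQ
  have hqp : ((q : ZMod l)) ^ p = 1 := by
    have : (Qn q p : ZMod l) * ((q : ZMod l) - 1) = (q : ZMod l) ^ p - 1 := by
      unfold Qn; push_cast; exact geom_sum_mul _ _
    rw [hQ0, zero_mul] at this
    exact (sub_eq_zero.1 this.symm)
  have hq1 : (q : ZMod l) ≠ 1 := by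
    intro h
    unfold Qn at hQ0
    push_cast at hQ0
    rw [h] at hQ0
    simp at hQ0
    rw [ZMod.natCast_eq_zero_iff, Nat.prime_dvd_prime_iff_eq hl hp] at hQ0
    exact hlp hQ0
  have hord : orderOf (q : ZMod l) = p := by
    have := Fact.mk hp
    exact orderOf_eq_prime hqp hq1
  have hq0 : (q : ZMod l) ≠ 0 := by
    intro h; rw [h, zero_pow hp.ne_zero] at hqp; exact zero_ne_one hqp
  have h1 : p ∣ l - 1 := by
    rw [← hord]
    exact orderOf_dvd_of_pow_eq_one (ZMod.pow_card_sub_one_eq_one hq0)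
  have hQodd : Odd (Qn q p) := by
    unfold Qn
    rw [Finset.odd_sum_iff_odd_card_odd]
    rw [Finset.filter_true_of_mem]
    · simpa using hodd
    · intro i _; exact hqo.pow
  have hlo : Odd l := Odd.of_dvd_nat hQodd hlQ
  have h2 : 2 ∣ l - 1 := by
    obtain ⟨k, hk⟩ := hlo; exact ⟨k, by omega⟩
  exact Nat.Coprime.mul_dvd_of_dvd_of_dvd (Nat.coprime_two_left.2 hodd) h2 h1

theorem num3 (q e : ℕ) (he : 0 < e) (hq : q = 3 ^ e) :
    ((2:ℝ) ^ (#(Qn q 3).primeFactors) - 1) * √(q : ℝ) < (q : ℝ) + 1 := by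
  have hqo : Odd q := by rw [hq]; exact (by decide : Odd 3).pow
  have hw := aux_omega 32 (Qn q 3) (Qn_pos _ _ (by norm_num)) {7, 13, 19, 31} (by decide) (by
    intro l hl hld hlt
    have := Qn_prime 3 q l Nat.prime_three (by decide) (hq ▸ dvd_pow_self 3 he.ne') hqo hl hld
    have h2 := hl.two_le
    clear hld
    interval_cases l <;> first | omega | decide | (exfalso; revert hl; norm_num))
  have hprod : ∏ l ∈ ({7, 13, 19, 31} : Finset ℕ), l = 53599 := by decide
  rw [hprod, show #({7, 13, 19, 31} : Finset ℕ) = 4 by decide] at hw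
  have hQv : Qn q 3 = 1 + q + q ^ 2 := by simp [Qn, Finset.sum_range_succ]
  set w := #(Qn q 3).primeFactors with hwd
  rw [hQv] at hw
  have small : ∀ k s : ℕ, w ≤ k → q < s ^ 2 → (2 ^ k - 1) * s ≤ q + 1 →
      ((2:ℝ) ^ w - 1) * √(q : ℝ) < (q : ℝ) + 1 := by
    intro k s hk hs h
    have h1 : √(q:ℝ) < s := by
      rw [Real.sqrt_lt' (by exact_mod_cast (by rcases Nat.eq_zero_or_pos s with h | h; (subst h; simp at hs); exact h))]
      exact_mod_cast hs
    have h2 : (2:ℝ) ^ w ≤ 2 ^ k := pow_le_pow_right₀ (by norm_num) hk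
    have h3 : ((2:ℝ) ^ k - 1) * s ≤ q + 1 := by
      have := (Nat.cast_le (α := ℝ)).2 h
      push_cast [Nat.one_le_two_pow] at this
      exact this
    have h0 := Real.sqrt_nonneg (q:ℝ)
    have h4 : (1:ℝ) ≤ 2 ^ k := one_le_pow₀ (by norm_num)
    have hq0 : (0:ℝ) ≤ q := by positivity
    rcases h4.eq_or_lt with h5 | h5
    · rw [← h5] at h2
      nlinarith
    · nlinarith
  by_cases h6 : e < 6
  · have key : ∀ k : ℕ, 32 ^ 4 * (1 + q + q ^ 2) < 32 ^ (k + 1) * 53599 → w ≤ k := by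
      intro k hk
      by_contra hlt
      have : 32 ^ (k + 1) ≤ 32 ^ w := Nat.pow_le_pow_right (by norm_num) (by omega)
      have := Nat.mul_le_mul_right 53599 this
      omega
    interval_cases e
    · norm_num at hq; subst hq
      exact small 1 2 (key 1 (by norm_num)) (by norm_num) (by norm_num)
    · norm_num at hq; subst hq
      have hk := key 2 (by norm_num)
      have hs : √((9:ℕ):ℝ) = 3 := by
        rw [show ((9:ℕ):ℝ) = 3 ^ 2 by norm_num]; exact Real.sqrt_sq (by norm_num)
      rw [hs]
      have h2 : (2:ℝ) ^ w ≤ 2 ^ 2 := pow_le_pow_right₀ (by norm_num) hk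
      norm_num at h2 ⊢
      linarith
    · norm_num at hq; subst hq
      exact small 2 6 (key 2 (by norm_num)) (by norm_num) (by norm_num)
    · norm_num at hq; subst hq
      exact small 3 10 (key 3 (by norm_num)) (by norm_num) (by norm_num)
    · norm_num at hq; subst hq
      exact small 4 16 (key 4 (by norm_num)) (by norm_num) (by norm_num)
  · have hq729 : 729 ≤ q := by
      rw [hq]; calc 729 = 3 ^ 6 := by norm_num
        _ ≤ 3 ^ e := Nat.pow_le_pow_right (by norm_num) (by omega)
    set s := √(q:ℝ) with hs
    have hs2 : s ^ 2 = q := Real.sq_sqrt (by positivity)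
    have hs27 : 27 ≤ s := by
      rw [hs]; apply Real.le_sqrt_of_sq_le; norm_num; exact_mod_cast hq729
    have hW : (2:ℝ) ^ w ≤ s := by
      by_contra hcon
      push Not at hcon
      have hw' : (32:ℝ) ^ w * 53599 ≤ 32 ^ 4 * (1 + q + q ^ 2) := by exact_mod_cast hw
      have h32 : (32:ℝ) ^ w = ((2:ℝ) ^ w) ^ 5 := by
        rw [← pow_mul, mul_comm, pow_mul]; norm_num
      have h5 : s ^ 5 ≤ ((2:ℝ) ^ w) ^ 5 := by gcongr
      have hq' : (729:ℝ) ≤ q := by exact_mod_cast hq729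
      have h6 : s ^ 5 = q ^ 2 * s := by rw [← hs2]; ring
      have h7 : (q:ℝ) ^ 2 * 27 ≤ q ^ 2 * s := by gcongr
      rw [h32] at hw'
      nlinarith
    have hspos : 0 < s := by linarith
    nlinarith

theorem num_p7 (p q : ℕ) (hp : p.Prime) (hp5 : 7 ≤ p) (hqp : p ≤ q) (hpq : p ∣ q)
    (hodd : Odd p) (hqo : Odd q) :
    ((2:ℝ) ^ (#(Qn q p).primeFactors) - 1) * (2 * √((q : ℝ) ^ p)) <
      (q : ℝ) ^ (p - 1) - (q : ℝ) ^ (p - 2) := by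
  have hw := aux_omega 16 (Qn q p) (Qn_pos _ _ hp.pos) ∅ (by simp) (by
    intro l hl hld hlt
    exfalso
    have := Qn_prime p q l hp hodd hpq hqo hl hld
    have h2 := hl.two_le
    have h3 := Nat.le_of_dvd (by omega) this
    have : l = 15 := by omega
    rw [this] at hl
    revert hl; norm_num)
  simp only [prod_empty, mul_one, card_empty, pow_zero, one_mul] at hw
  set w := #(Qn q p).primeFactors with hwd
  have hQ := Qn_lt q p (by omega)
  set Q := Qn q p with hQd
  have hq7 : (7:ℝ) ≤ q := by exact_mod_cast (by omega : 7 ≤ q)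
  have hw' : (16:ℝ) ^ w ≤ Q := by exact_mod_cast hw
  have hQ' : (Q:ℝ) * (q - 1) < q ^ p := by
    have := (Nat.cast_lt (α := ℝ)).2 hQ
    push_cast [show 1 ≤ q by omega] at this
    exact this
  have h16 : (16:ℝ) ^ w = ((2:ℝ) ^ w) ^ 4 := by
    rw [← pow_mul, mul_comm, pow_mul]; norm_num
  rw [h16] at hw'
  set W := (2:ℝ) ^ w
  have hWpos : 0 < W := by positivity
  set r := √((q : ℝ) ^ p) with hr
  have hqpos : (0:ℝ) < q := by linarith
  have hr2 : r ^ 2 = (q:ℝ) ^ p := Real.sq_sqrt (by positivity)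
  have hrpos : 0 < r := Real.sqrt_pos.2 (by positivity)
  by_contra hcon
  push Not at hcon
  obtain ⟨k, rfl⟩ : ∃ k, p = k + 7 := ⟨p - 7, by omega⟩
  simp only [show k + 7 - 1 = k + 6 by omega, show k + 7 - 2 = k + 5 by omega] at hcon
  have h1 : (q:ℝ) ^ (k + 5) * (q - 1) ≤ 2 * W * r := by
    have : (q:ℝ) ^ (k + 5) * (q - 1) = (q:ℝ) ^ (k + 6) - (q:ℝ) ^ (k + 5) := by ring
    rw [this]; nlinarith
  have h2 : ((q:ℝ) ^ (k + 5) * (q - 1)) ^ 4 ≤ (2 * W * r) ^ 4 := by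
    apply pow_le_pow_left₀ _ h1
    apply mul_nonneg (by positivity); linarith
  have h3 : (2 * W * r) ^ 4 = 16 * W ^ 4 * ((q:ℝ) ^ (k + 7)) ^ 2 := by rw [← hr2]; ring
  rw [h3] at h2
  have h4 : ((q:ℝ) ^ (k + 5) * (q - 1)) ^ 4 * (q - 1) < 16 * (q ^ (k + 7)) * ((q:ℝ) ^ (k + 7)) ^ 2 := by
    calc _ ≤ 16 * W ^ 4 * ((q:ℝ) ^ (k + 7)) ^ 2 * (q - 1) :=
          mul_le_mul_of_nonneg_right h2 (by linarith)
      _ ≤ 16 * Q * ((q:ℝ) ^ (k + 7)) ^ 2 * (q - 1) := by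
          apply mul_le_mul_of_nonneg_right _ (by linarith)
          gcongr
      _ = 16 * (Q * (q - 1)) * ((q:ℝ) ^ (k + 7)) ^ 2 := by ring
      _ < _ := by gcongr
  -- q^(4k+20) (q-1)^5 < 16 q^(3k+21)
  have h5 : (q:ℝ) ^ (3 * k + 20) * (q ^ k * (q - 1) ^ 5) < (q:ℝ) ^ (3 * k + 20) * (16 * q) := by
    calc _ = ((q:ℝ) ^ (k + 5) * (q - 1)) ^ 4 * (q - 1) := by ring
      _ < _ := h4
      _ = _ := by ring
  have h6 := lt_of_mul_lt_mul_left h5 (by positivity)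
  have h7 : (1:ℝ) ≤ q ^ k := one_le_pow₀ (by linarith)
  have h8 : (6:ℝ) ^ 4 * (q - 1) ≤ (q - 1) ^ 5 := by
    have : (6:ℝ) ^ 4 ≤ (q - 1) ^ 4 := by gcongr; linarith
    nlinarith
  have h9 : (0:ℝ) ≤ (q - 1) ^ 5 := by apply pow_nonneg; linarith
  nlinarith

theorem num_p5 (q e : ℕ) (he : 0 < e) (hq : q = 5 ^ e) :
    ((2:ℝ) ^ (#(Qn q 5).primeFactors) - 1) * (2 * √((q : ℝ) ^ 5)) <
      (q : ℝ) ^ 4 - (q : ℝ) ^ 3 := by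
  have hqo : Odd q := by rw [hq]; exact (by decide : Odd 5).pow
  have hw := aux_omega 16 (Qn q 5) (Qn_pos _ _ (by norm_num)) {11} (by decide) (by
    intro l hl hld hlt
    have := Qn_prime 5 q l Nat.prime_five (by decide) (hq ▸ dvd_pow_self 5 he.ne') hqo hl hld
    have h2 := hl.two_le
    clear hld
    interval_cases l <;> first | omega | decide)
  simp only [prod_singleton, card_singleton, pow_one] at hw
  set w := #(Qn q 5).primeFactors with hwd
  have hq5 : 5 ≤ q := hq ▸ Nat.le_self_pow he.ne' 5
  set r := √((q : ℝ) ^ 5) with hr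
  have hr2 : r ^ 2 = (q:ℝ) ^ 5 := Real.sq_sqrt (by positivity)
  have hrpos : 0 < r := Real.sqrt_pos.2 (by positivity)
  rcases Nat.lt_or_ge e 2 with h | h
  · have : e = 1 := by omega
    subst this
    norm_num at hq
    subst hq
    have hQv : Qn 5 5 = 781 := by decide
    rw [hQv] at hw
    have hk : w ≤ 2 := by
      by_contra hlt
      have : 16 ^ 3 ≤ 16 ^ w := Nat.pow_le_pow_right (by norm_num) (by omega)
      omega
    have h2 : (2:ℝ) ^ w ≤ 2 ^ 2 := pow_le_pow_right₀ (by norm_num) hk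
    have h3 : r < 60 := by
      norm_num at hr2
      nlinarith
    norm_num at h2 ⊢
    nlinarith
  · have hq25 : 25 ≤ q := by
      rw [hq]; calc 25 = 5 ^ 2 := by norm_num
        _ ≤ 5 ^ e := Nat.pow_le_pow_right (by norm_num) h
    have hQ := Qn_lt q 5 (by omega)
    set Q := Qn q 5 with hQd
    have hq7 : (25:ℝ) ≤ q := by exact_mod_cast hq25
    have hw' : (16:ℝ) ^ w * 11 ≤ 16 * Q := by exact_mod_cast hw
    have hQ' : (Q:ℝ) * (q - 1) < q ^ 5 := by
      have := (Nat.cast_lt (α := ℝ)).2 hQ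
      push_cast [show 1 ≤ q by omega] at this
      exact this
    have h16 : (16:ℝ) ^ w = ((2:ℝ) ^ w) ^ 4 := by
      rw [← pow_mul, mul_comm, pow_mul]; norm_num
    rw [h16] at hw'
    set W := (2:ℝ) ^ w
    have hWpos : 0 < W := by positivity
    have hqpos : (0:ℝ) < q := by linarith
    by_contra hcon
    push Not at hcon
    have h1 : (q:ℝ) ^ 3 * (q - 1) ≤ 2 * W * r := by
      have : (q:ℝ) ^ 3 * (q - 1) = (q:ℝ) ^ 4 - (q:ℝ) ^ 3 := by ring
      rw [this]; nlinarith
    have h2 : ((q:ℝ) ^ 3 * (q - 1)) ^ 4 ≤ (2 * W * r) ^ 4 := by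
      apply pow_le_pow_left₀ _ h1
      apply mul_nonneg (by positivity); linarith
    have h3 : (2 * W * r) ^ 4 = 16 * W ^ 4 * ((q:ℝ) ^ 5) ^ 2 := by rw [← hr2]; ring
    rw [h3] at h2
    have h4 : 11 * (((q:ℝ) ^ 3 * (q - 1)) ^ 4 * (q - 1)) < 256 * (q ^ 5) * ((q:ℝ) ^ 5) ^ 2 := by
      calc _ ≤ 11 * (16 * W ^ 4 * ((q:ℝ) ^ 5) ^ 2 * (q - 1)) := by
            apply mul_le_mul_of_nonneg_left _ (by norm_num)
            exact mul_le_mul_of_nonneg_right h2 (by linarith)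
        _ = 16 * (W ^ 4 * 11) * ((q:ℝ) ^ 5) ^ 2 * (q - 1) := by ring
        _ ≤ 16 * (16 * Q) * ((q:ℝ) ^ 5) ^ 2 * (q - 1) := by
            apply mul_le_mul_of_nonneg_right _ (by linarith)
            gcongr
        _ = 256 * (Q * (q - 1)) * ((q:ℝ) ^ 5) ^ 2 := by ring
        _ < _ := by gcongr
    have h5 : (q:ℝ) ^ 12 * (11 * (q - 1) ^ 5) < (q:ℝ) ^ 12 * (256 * q ^ 3) := by
      calc _ = 11 * (((q:ℝ) ^ 3 * (q - 1)) ^ 4 * (q - 1)) := by ring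
        _ < _ := h4
        _ = _ := by ring
    have h6 := lt_of_mul_lt_mul_left h5 (by positivity)
    have h7 : q ≤ 2 * ((q:ℝ) - 1) := by linarith
    have h8 : (q:ℝ) ^ 3 ≤ (2 * ((q:ℝ) - 1)) ^ 3 := by gcongr
    have h10 : (24:ℝ) ^ 2 * (q - 1) ^ 3 ≤ (q - 1) ^ 2 * (q - 1) ^ 3 := by
      apply mul_le_mul_of_nonneg_right
      · gcongr; linarith
      · apply pow_nonneg; linarith
    have h9 : (0:ℝ) < (q - 1) ^ 3 := by apply pow_pos; linarith
    nlinarith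

/-- common endgame for `n = 2p` -/
theorem num_2p (m q T P : ℕ) (hm : 2 ≤ m) (hq : 3 ≤ q)
    (hw : 16 ^ (#(Qn q (2 * m)).primeFactors) * P ≤ 16 ^ T * Qn q (2 * m))
    (hbig : 256 * 16 ^ T * q ^ (2 * m) ≤ P * (q ^ (m - 2) * (q - 2)) ^ 4 * (q - 1)) :
    ((2:ℝ) ^ (#(Qn q (2 * m)).primeFactors) - 1) * (4 * (q : ℝ) ^ m) <
      (q : ℝ) ^ (2 * m - 1) - 2 * (q : ℝ) ^ (2 * m - 2) := by
  set w := #(Qn q (2 * m)).primeFactors with hwd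
  have hQ := Qn_lt q (2 * m) (by omega)
  set Q := Qn q (2 * m) with hQd
  by_contra hcon
  push Not at hcon
  obtain ⟨k, rfl⟩ : ∃ k, m = k + 2 := ⟨m - 2, by omega⟩
  obtain ⟨t, rfl⟩ : ∃ t, q = t + 2 := ⟨q - 2, by omega⟩
  simp only [show 2 * (k + 2) - 1 = 2 * k + 3 by omega, show 2 * (k + 2) - 2 = 2 * k + 2 by omega]
    at hcon
  simp only [Nat.add_sub_cancel, show t + 2 - 1 = t + 1 by omega] at hbig hQ
  have hW : (t + 2) ^ k * t ≤ 4 * 2 ^ w := by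
    have h1 : ((t + 2 : ℕ) : ℝ) ^ (k + 2) * (((t + 2 : ℕ) : ℝ) ^ k * t) ≤
        ((t + 2 : ℕ) : ℝ) ^ (k + 2) * (4 * 2 ^ w) := by
      have e1 : ((t + 2 : ℕ) : ℝ) ^ (k + 2) * (((t + 2 : ℕ) : ℝ) ^ k * t) =
          ((t + 2 : ℕ) : ℝ) ^ (2 * k + 3) - 2 * ((t + 2 : ℕ) : ℝ) ^ (2 * k + 2) := by
        push_cast; ring
      rw [e1]
      have : (0:ℝ) ≤ ((t + 2 : ℕ) : ℝ) ^ (k + 2) := by positivity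
      nlinarith
    have h2 := le_of_mul_le_mul_left h1 (by positivity)
    exact_mod_cast h2
  have h16 : 16 ^ w = (2 ^ w) ^ 4 := by
    rw [← pow_mul, mul_comm, pow_mul]; norm_num
  rw [h16] at hw
  have h4 : P * ((t + 2) ^ k * t) ^ 4 * (t + 1) ≤ 256 * 16 ^ T * (Q * (t + 1)) := by
    calc P * ((t + 2) ^ k * t) ^ 4 * (t + 1) ≤ P * (4 * 2 ^ w) ^ 4 * (t + 1) := by gcongr
      _ = 256 * ((2 ^ w) ^ 4 * P) * (t + 1) := by ring
      _ ≤ 256 * (16 ^ T * Q) * (t + 1) := by gcongr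
      _ = _ := by ring
  have h5 : 256 * 16 ^ T * (Q * (t + 1)) < 256 * 16 ^ T * (t + 2) ^ (2 * (k + 2)) := by gcongr
  omega

theorem num6 (q e : ℕ) (he : 3 ≤ e) (hq : q = 3 ^ e) :
    ((2:ℝ) ^ (#(Qn q 6).primeFactors) - 1) * (4 * (q : ℝ) ^ 3) <
      (q : ℝ) ^ 5 - 2 * (q : ℝ) ^ 4 := by
  have hw := aux_omega 16 (Qn q 6) (Qn_pos _ _ (by norm_num)) {2, 5, 7, 11, 13} (by decide) (by
    intro l hl hld hlt
    have h3 : l ≠ 3 := by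
      rintro rfl
      exact Qn_not_dvd 3 q 6 hl (hq ▸ dvd_pow_self 3 (by omega)) (by norm_num) hld
    have h2 := hl.two_le
    clear hld
    interval_cases l <;> first | omega | decide | (exfalso; revert hl; norm_num))
  rw [show ∏ l ∈ ({2, 5, 7, 11, 13} : Finset ℕ), l = 10010 by decide,
    show #({2, 5, 7, 11, 13} : Finset ℕ) = 5 by decide] at hw
  rcases Nat.lt_or_ge e 4 with h | h
  · have : e = 3 := by omega
    subst this
    norm_num at hq
    subst hq
    have hQv : Qn 27 6 = 14900788 := by decide
    set w := #(Qn 27 6).primeFactors with hwd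
    rw [hQv] at hw
    have hk : w ≤ 7 := by
      by_contra hlt
      have : 16 ^ 8 ≤ 16 ^ w := Nat.pow_le_pow_right (by norm_num) (by omega)
      omega
    have h2 : (2:ℝ) ^ w ≤ 2 ^ 7 := pow_le_pow_right₀ (by norm_num) hk
    norm_num at h2 ⊢
    linarith
  · have hq81 : 81 ≤ q := by
      rw [hq]; calc 81 = 3 ^ 4 := by norm_num
        _ ≤ 3 ^ e := Nat.pow_le_pow_right (by norm_num) h
    refine num_2p 3 q 5 10010 (by norm_num) (by omega) hw ?_
    obtain ⟨t, rfl⟩ : ∃ t, q = t + 2 := ⟨q - 2, by omega⟩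
    simp only [Nat.add_sub_cancel, show t + 2 - 1 = t + 1 by omega]
    have h1 : 79 ≤ t := by omega
    have h2 : (t + 2) ^ 2 ≤ 2 * t ^ 2 := by nlinarith
    calc 256 * 16 ^ 5 * (t + 2) ^ (2 * 3) = (t + 2) ^ 4 * (256 * 16 ^ 5 * (t + 2) ^ 2) := by ring
      _ ≤ (t + 2) ^ 4 * (256 * 16 ^ 5 * (2 * t ^ 2)) := by gcongr
      _ = (t + 2) ^ 4 * t ^ 2 * 536870912 := by ring
      _ ≤ (t + 2) ^ 4 * t ^ 2 * (10010 * (79 ^ 2 * (79 + 1))) := by gcongr; norm_num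
      _ ≤ (t + 2) ^ 4 * t ^ 2 * (10010 * (t ^ 2 * (t + 1))) := by gcongr
      _ = 10010 * ((t + 2) ^ (3 - 2) * t) ^ 4 * (t + 1) := by norm_num; ring

theorem num10 (p q e : ℕ) (hp : p.Prime) (hp5 : 5 ≤ p) (he : 0 < e) (hq : q = p ^ e) :
    ((2:ℝ) ^ (#(Qn q (2 * p)).primeFactors) - 1) * (4 * (q : ℝ) ^ p) <
      (q : ℝ) ^ (2 * p - 1) - 2 * (q : ℝ) ^ (2 * p - 2) := by
  have hpq : p ≤ q := hq ▸ Nat.le_self_pow he.ne' p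
  by_cases h55 : q = 5
  · have : p = 5 := by omega
    subst this
    subst h55
    have hQv : Qn 5 (2 * 5) = 2 * 3 * (11 * (71 * 521)) := by decide
    have hcard : #(Qn 5 (2 * 5)).primeFactors ≤ 5 := by
      rw [hQv, Nat.primeFactors_mul (by norm_num) (by norm_num),
        Nat.primeFactors_mul (by norm_num) (by norm_num),
        Nat.primeFactors_mul (by norm_num) (by norm_num),
        Nat.primeFactors_mul (by norm_num) (by norm_num),
        Nat.Prime.primeFactors (by norm_num), Nat.Prime.primeFactors (by norm_num),
        Nat.Prime.primeFactors (by norm_num), Nat.Prime.primeFactors (by norm_num),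
        Nat.Prime.primeFactors (by norm_num)]
      decide
    have h2 : (2:ℝ) ^ (#(Qn 5 (2 * 5)).primeFactors) ≤ 2 ^ 5 :=
      pow_le_pow_right₀ (by norm_num) hcard
    norm_num at h2 ⊢
    linarith
  · have hw := aux_omega 16 (Qn q (2 * p)) (Qn_pos _ _ (by omega)) {2, 3, 5, 7, 11, 13} (by decide) (by
      intro l hl hld hlt
      have h2 := hl.two_le
      clear hld
      interval_cases l <;> first | decide | (exfalso; revert hl; norm_num))
    rw [show ∏ l ∈ ({2, 3, 5, 7, 11, 13} : Finset ℕ), l = 30030 by decide,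
      show #({2, 3, 5, 7, 11, 13} : Finset ℕ) = 6 by decide] at hw
    refine num_2p p q 6 30030 (by omega) (by omega) hw ?_
    have key : 256 * 16 ^ 6 ≤ 30030 * (q ^ (2 * p - 8) * (q - 2) ^ 4 * (q - 1)) := by
      rcases Nat.lt_or_ge p 7 with h7 | h7
      · have : p = 5 := by
          interval_cases p
          · rfl
          · revert hp; norm_num
        subst this
        have h25 : 25 ≤ q := by
          have : 2 ≤ e := by
            by_contra h
            have : e = 1 := by omega
            subst this; exact h55 (by simpa using hq)
          rw [hq]; calc 25 = 5 ^ 2 := by norm_num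
            _ ≤ 5 ^ e := Nat.pow_le_pow_right (by norm_num) this
        calc 256 * 16 ^ 6 ≤ 30030 * (25 ^ (2 * 5 - 8) * 23 ^ 4 * 24) := by norm_num
          _ ≤ _ := by gcongr <;> omega
      · calc 256 * 16 ^ 6 ≤ 30030 * (7 ^ 6 * 5 ^ 4 * 6) := by norm_num
          _ ≤ 30030 * (q ^ 6 * (q - 2) ^ 4 * (q - 1)) := by gcongr <;> omega
          _ ≤ _ := by gcongr <;> omega
    obtain ⟨k, rfl⟩ : ∃ k, p = k + 4 := ⟨p - 4, by omega⟩
    simp only [show 2 * (k + 4) - 8 = 2 * k by omega, show k + 4 - 2 = k + 2 by omega] at key ⊢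
    calc 256 * 16 ^ 6 * q ^ (2 * (k + 4)) ≤ 30030 * (q ^ (2 * k) * (q - 2) ^ 4 * (q - 1)) *
          q ^ (2 * (k + 4)) := by gcongr
      _ = 30030 * (q ^ (k + 2) * (q - 2)) ^ 4 * (q - 1) := by ring

end numerics

section explicit
open Finset

/-- Horner evaluation of a coefficient list. -/
def ev {R : Type} [CommRing R] (r : R) : List ℕ → R
  | [] => 0
  | a :: l => (a : R) + r * ev r l

def lsm (c : ℕ) : List ℕ → List ℕ
  | [] => []
  | a :: l => (c * a % 3) :: lsm c l

def lad : List ℕ → List ℕ → List ℕ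
  | [], m => m
  | a :: l, [] => a :: l
  | a :: l, b :: m => ((a + b) % 3) :: lad l m

def lx (k : ℕ) (red t : List ℕ) : List ℕ :=
  match t.drop k with
  | [c] => lad (0 :: t.take k) (lsm c red)
  | _ => 0 :: t

def lmul (k : ℕ) (red : List ℕ) : List ℕ → List ℕ → List ℕ
  | [], _ => []
  | a :: l, m => lad (lsm a m) (lx k red (lmul k red l m))

def lpw (k : ℕ) (red l : List ℕ) : List Bool → List ℕ
  | [] => [1]
  | b :: bs =>
    let t := lpw k red l bs
    let u := lmul k red t t
    if b then lmul k red l u else u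

def bval : List Bool → ℕ
  | [] => 0
  | b :: bs => 2 * bval bs + (if b then 1 else 0)

theorem cast_mod3 {R : Type} [CommRing R] (h3 : (3:R) = 0) (a : ℕ) : ((a % 3 : ℕ) : R) = a := by
  conv_rhs => rw [← Nat.mod_add_div a 3]
  push_cast
  rw [h3]; ring

theorem ev_lsm {R : Type} [CommRing R] (h3 : (3:R) = 0) (r : R) (c : ℕ) (l : List ℕ) :
    ev r (lsm c l) = c * ev r l := by
  induction l with
  | nil => simp [lsm, ev]
  | cons a l ih => simp only [lsm, ev, ih, cast_mod3 h3]; push_cast; ring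

theorem ev_lad {R : Type} [CommRing R] (h3 : (3:R) = 0) (r : R) (l m : List ℕ) :
    ev r (lad l m) = ev r l + ev r m := by
  induction l generalizing m with
  | nil => simp [lad, ev]
  | cons a l ih =>
    cases m with
    | nil => simp [lad, ev]
    | cons b m => simp only [lad, ev, ih, cast_mod3 h3]; push_cast; ring

theorem ev_take_drop {R : Type} [CommRing R] (r : R) (k : ℕ) (l : List ℕ) :
    ev r l = ev r (l.take k) + r ^ k * ev r (l.drop k) := by
  induction k generalizing l with
  | zero => simp [ev]
  | succ k ih =>
    cases l with
    | nil => simp [ev]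
    | cons a l => simp only [List.take_succ_cons, List.drop_succ_cons, ev]; rw [ih l]; ring

theorem ev_lx {R : Type} [CommRing R] (h3 : (3:R) = 0) (r : R) (k : ℕ) (red t : List ℕ)
    (hr : r ^ (k + 1) = ev r red) : ev r (lx k red t) = r * ev r t := by
  unfold lx
  split
  · rename_i c hc
    rw [ev_lad h3, ev_lsm h3, ← hr, ev_take_drop r k t, hc]
    simp only [ev]
    push_cast
    ring
  · simp [ev]

theorem ev_lmul {R : Type} [CommRing R] (h3 : (3:R) = 0) (r : R) (k : ℕ) (red l m : List ℕ)
    (hr : r ^ (k + 1) = ev r red) : ev r (lmul k red l m) = ev r l * ev r m := by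
  induction l with
  | nil => simp [lmul, ev]
  | cons a l ih =>
    simp only [lmul, ev]
    rw [ev_lad h3, ev_lsm h3, ev_lx h3 r k red _ hr, ih]
    ring

theorem ev_lpw {R : Type} [CommRing R] (h3 : (3:R) = 0) (r : R) (k : ℕ) (red l : List ℕ)
    (hr : r ^ (k + 1) = ev r red) (bs : List Bool) :
    ev r (lpw k red l bs) = ev r l ^ (bval bs) := by
  induction bs with
  | nil => simp [lpw, ev, bval]
  | cons b bs ih =>
    cases b
    · simp only [lpw, bval, ev_lmul h3 r k red _ _ hr, ih, Bool.false_eq_true, if_false]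
      ring
    · simp only [lpw, bval, ev_lmul h3 r k red _ _ hr, ih, if_true]
      ring

theorem ev_X_degree {K : Type} [Field K] (l : List ℕ) :
    (ev (X : K[X]) l).degree < ((l.length : ℕ) : WithBot ℕ) := by
  induction l with
  | nil => simp [ev]
  | cons a l ih =>
    simp only [ev, List.length_cons]
    refine lt_of_le_of_lt (degree_add_le _ _) (max_lt ?_ ?_)
    · have h0 : ((a : ℕ) : K[X]).degree ≤ 0 := by
        rw [← C_eq_natCast]; exact degree_C_le
      refine lt_of_le_of_lt h0 ?_
      exact_mod_cast Nat.succ_pos _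
    · by_cases h : ev (X : K[X]) l = 0
      · rw [h, mul_zero, degree_zero]; exact WithBot.bot_lt_coe _
      · rw [degree_mul, degree_X, degree_eq_natDegree h]
        rw [degree_eq_natDegree h] at ih
        have : (ev (X : K[X]) l).natDegree < l.length := by exact_mod_cast ih
        have h2 : 1 + (ev (X : K[X]) l).natDegree < l.length + 1 := by omega
        exact_mod_cast h2

theorem ev_map {R S : Type} [CommRing R] [CommRing S] (f : R →+* S) (r : R) (l : List ℕ) :
    f (ev r l) = ev (f r) l := by
  induction l with
  | nil => simp [ev]
  | cons a l ih => simp [ev, ih]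

/-- Existence of a root of the defining polynomial. -/
theorem exists_root {K : Type} [Field K] [Fintype K] (h3 : (3:K) = 0) (k : ℕ) (red : List ℕ)
    (hlen : red.length = k + 1) (bs : List Bool) (hbs : bval bs = Fintype.card K)
    (hc : lpw k red [0, 1] bs = lad [0,1] (lsm 0 red)) :
    ∃ r : K, r ^ (k + 1) = ev r red := by
  classical
  set f : K[X] := X ^ (k + 1) - ev X red with hf
  have hdX : (ev (X : K[X]) red).degree < ((k + 1 : ℕ) : WithBot ℕ) := hlen ▸ ev_X_degree red
  have hdeg : f.degree = ((k + 1 : ℕ) : WithBot ℕ) := by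
    rw [hf, degree_sub_eq_left_of_degree_lt] <;> rw [degree_X_pow]
    exact hdX
  have h3' : (3 : AdjoinRoot f) = 0 := by
    have := congrArg (AdjoinRoot.of f) h3
    rw [map_zero, map_ofNat] at this
    exact this
  have hroot : (AdjoinRoot.root f) ^ (k + 1) = ev (AdjoinRoot.root f) red := by
    have h : AdjoinRoot.mk f (X ^ (k + 1) - ev X red) = 0 := AdjoinRoot.mk_self
    rw [map_sub, map_pow, ev_map, AdjoinRoot.mk_X, sub_eq_zero] at h
    exact h
  have h1 := ev_lpw h3' (AdjoinRoot.root f) k red [0, 1] hroot bs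
  rw [hc, hbs, ev_lad h3', ev_lsm h3'] at h1
  simp only [ev] at h1
  have h2 : AdjoinRoot.mk f (X ^ Fintype.card K - X) = 0 := by
    rw [map_sub, map_pow, AdjoinRoot.mk_X, sub_eq_zero]
    simpa using h1.symm
  rw [AdjoinRoot.mk_eq_zero] at h2
  have hsp : Splits (X ^ Fintype.card K - X : K[X]) := by
    rw [splits_iff_card_roots, FiniteField.roots_X_pow_card_sub_X, ← Finset.card_def,
      Finset.card_univ, FiniteField.X_pow_card_sub_X_natDegree_eq K Fintype.one_lt_card]
  have hs := hsp.of_dvd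
    (FiniteField.X_pow_card_sub_X_ne_zero K Fintype.one_lt_card) h2
  obtain ⟨r, hr⟩ := hs.exists_eval_eq_zero (by rw [hdeg]; exact_mod_cast Nat.succ_ne_zero k)
  refine ⟨r, ?_⟩
  rw [hf, eval_sub, eval_pow, eval_X, sub_eq_zero, ← coe_evalRingHom, ev_map] at hr
  simpa using hr

theorem aux_expl {F K : Type} [Field F] [Fintype F] [Field K] [Fintype K] [Algebra F K]
    (h3 : (3:K) = 0) (α : K) (f0 f1 f2 f3 f4 f5 i1 i2 : K)
    (e0 : α ^ (Fintype.card F) ^ 0 = f0) (e1 : α ^ (Fintype.card F) ^ 1 = f1)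
    (e2 : α ^ (Fintype.card F) ^ 2 = f2)
    (e3 : α ^ (Fintype.card F) ^ 3 = f3) (e4 : α ^ (Fintype.card F) ^ 4 = f4)
    (e5 : α ^ (Fintype.card F) ^ 5 = f5)
    (ht : f0 + (f1 + (f2 + (f3 + (f4 + f5)))) = 0)
    (h1 : (f4 + (f3 + (f3 + (f1 + (f0 + f0))))) * i1 = 1)
    (h2 : (f4 + (f2 + f0)) * i2 = 1) :
    IskNormal (Fintype.card F) 6 1 F α := by
  have g0 : (sg F K ^ 0) α = f0 := by rw [sg_pow, e0]
  have g1 : (sg F K ^ 1) α = f1 := by rw [sg_pow, e1]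
  have g2 : (sg F K ^ 2) α = f2 := by rw [sg_pow, e2]
  have g3 : (sg F K ^ 3) α = f3 := by rw [sg_pow, e3]
  have g4 : (sg F K ^ 4) α = f4 := by rw [sg_pow, e4]
  have g5 : (sg F K ^ 5) α = f5 := by rw [sg_pow, e5]
  rw [pow_zero, Module.End.one_apply] at g0
  rw [pow_one] at g1
  apply aux_normal 2 3 α
  · have : hp F 2 3 = X ^ 5 + X ^ 4 - (X ^ 3 + X ^ 3) - (X ^ 2 + X ^ 2) + X + 1 := by
      simp only [hp, map_one]; ring
    rw [this]
    simp only [map_add, map_sub, map_pow, aeval_X, map_one, LinearMap.add_apply,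
      LinearMap.sub_apply, Module.End.one_apply, g1, g2, g3, g4, g5]
    rw [g0]
    linear_combination ht - (f3 + f2) * h3
  · intro _ h
    have e : hp F (2 - 1) 3 = X ^ 4 + (X ^ 3 + X ^ 3) - (X + X) - 1 := by
      simp only [hp, map_one]; ring
    rw [e] at h
    simp only [map_add, map_sub, map_pow, aeval_X, map_one, LinearMap.add_apply,
      LinearMap.sub_apply, Module.End.one_apply, g1, g3, g4] at h
    rw [g0] at h
    rw [show f4 + (f3 + (f3 + (f1 + (f0 + f0)))) = 0 by
      linear_combination h + (f1 + f0) * h3] at h1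
    simp at h1
  · intro _ h
    have e : hp F 2 (3 - 1) = X ^ 4 - (X ^ 2 + X ^ 2) + 1 := by
      simp only [hp, map_one]; ring
    rw [e] at h
    simp only [map_add, map_sub, map_pow, aeval_X, map_one, LinearMap.add_apply,
      LinearMap.sub_apply, Module.End.one_apply, g2, g4] at h
    rw [g0] at h
    rw [show f4 + (f2 + f0) = 0 by linear_combination h + f2 * h3] at h2
    simp at h2

theorem aux_prim_of_order {K : Type} [Field K] [Fintype K] (α : K) (h0 : α ≠ 0)
    (h : ∀ l : ℕ, l.Prime → l ∣ Fintype.card K - 1 → α ^ ((Fintype.card K - 1) / l) ≠ 1) :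
    IsPrimitiveElt α := by
  classical
  intro b hb
  have hord : orderOf (Units.mk0 α h0) = Fintype.card K - 1 := by
    rw [← orderOf_units]
    exact orderOf_eq_of_pow_and_pow_div_prime (Nat.sub_pos_of_lt Fintype.one_lt_card)
      (FiniteField.pow_card_sub_one_eq_one α h0) h
  have hmem : Units.mk0 b hb ∈ Subgroup.zpowers (Units.mk0 α h0) := by
    have : Subgroup.zpowers (Units.mk0 α h0) = ⊤ := by
      apply Subgroup.eq_top_of_card_eq
      rw [Nat.card_zpowers, hord, Nat.card_eq_fintype_card, Fintype.card_units]
    rw [this]; trivial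
  rw [← mem_powers_iff_mem_zpowers] at hmem
  obtain ⟨m, hm⟩ := hmem
  exact ⟨m, by simpa using congrArg Units.val hm⟩

theorem aux_ne_one {K : Type} [Field K] (h3 : (3:K) = 0) (r : K) (k : ℕ) (red : List ℕ)
    (hr : r ^ (k + 1) = ev r red) (bs : List Bool) (n : ℕ) (hn : bval bs = n) (i one : List ℕ)
    (hone : ev r one = 1)
    (h : lmul k red i (lad (lpw k red [0, 1] bs) [2]) = one) : r ^ n ≠ 1 := by
  intro h1
  have h2 := congrArg (ev r) h
  rw [ev_lmul h3 r k red _ _ hr, ev_lad h3, ev_lpw h3 r k red _ hr, hn, hone] at h2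
  have : ev r [0, 1] = r := by simp [ev]
  rw [this, h1] at h2
  have h4 : (1:K) + ev r [2] = 0 := by
    simp only [ev]; push_cast; linear_combination h3
  rw [h4] at h2
  simp at h2

/-- Binary digits of `n`, least significant first. -/
def bits : ℕ → ℕ → List Bool
  | 0, _ => []
  | s + 1, n => (n % 2 == 1) :: bits s (n / 2)

theorem bval_bits (s n : ℕ) (h : n < 2 ^ s) : bval (bits s n) = n := by
  induction s generalizing n with
  | zero => simp at h; simp [bits, bval, h]
  | succ s ih =>
    simp only [bits, bval]
    rw [ih (n / 2) (by rw [pow_succ] at h; omega)]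
    rcases Nat.mod_two_eq_zero_or_one n with h | h <;> simp [h] <;> omega

end explicit

section explicit2

theorem h3_of_card {F K : Type} [Field F] [Fintype F] [Field K] [Algebra F K] (e : ℕ)
    (h : Fintype.card F = 3 ^ e) : (3:K) = 0 := by
  have h1 : ((Fintype.card F : ℕ) : F) = 0 := FiniteField.cast_card_eq_zero F
  rw [h, Nat.cast_pow] at h1
  have h2 : ((3:ℕ):F) = 0 := eq_zero_of_pow_eq_zero h1
  have := congrArg (algebraMap F K) h2
  rw [map_zero, map_natCast] at this
  exact_mod_cast this

abbrev rd6 : List ℕ := [1, 1, 0, 0, 0, 0]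
abbrev rd12 : List ℕ := [1, 0, 2, 2, 0, 1, 0, 0, 0, 0, 0, 0]

theorem aux_step {K : Type} [Field K] (h3 : (3:K) = 0) (r x : K) (k : ℕ) (red : List ℕ)
    (hr : r ^ (k + 1) = ev r red) (q i s : ℕ) (hq : q < 2 ^ s) (l m : List ℕ)
    (hx : x ^ q ^ i = ev r l) (h : lpw k red l (bits s q) = m) : x ^ q ^ (i + 1) = ev r m := by
  rw [← h, ev_lpw h3 r k red l hr, bval_bits s q hq, ← hx, ← pow_mul, pow_succ]

theorem expl_6 {F K : Type} [Field F] [Fintype F] [Field K] [Fintype K] [Algebra F K]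
    (hF : Fintype.card F = 3) (hr : Module.finrank F K = 6) :
    ∃ α : K, IsPrimitiveElt α ∧ IskNormal (Fintype.card F) 6 1 F α := by
  classical
  have hK : Fintype.card K = 729 := by
    rw [Module.card_eq_pow_finrank (K := F) (V := K), hr, hF]; norm_num
  have h3 : (3:K) = 0 := h3_of_card (F := F) 1 (by rw [hF]; norm_num)
  obtain ⟨r, hr⟩ := exists_root h3 5 rd6 rfl (bits 10 729)
    (by rw [bval_bits _ _ (by norm_num), hK]) (by decide +kernel)
  have hone : ev r [1, 0, 0, 0, 0, 0] = 1 := by simp [ev]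
  have hne : ∀ (n : ℕ) (i : List ℕ), n < 2 ^ 10 →
      lmul 5 rd6 i (lad (lpw 5 rd6 [0, 1] (bits 10 n)) [2]) = [1, 0, 0, 0, 0, 0] → r ^ n ≠ 1 := by
    intro n i hn hi
    exact aux_ne_one h3 r 5 rd6 hr _ n (bval_bits _ _ hn) i _ hone hi
  have hr0 : r ≠ 0 := by
    intro h
    rw [h] at hr
    simp [ev] at hr
  refine ⟨r, ?_, ?_⟩
  · apply aux_prim_of_order r hr0
    intro l hl hd
    rw [hK] at hd ⊢
    rw [show 729 - 1 = 2 ^ 3 * (7 * 13) by norm_num] at hd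
    rcases (Nat.Prime.dvd_mul hl).mp hd with hd | hd
    · replace hd := hl.dvd_of_dvd_pow hd
      have hl' := (Nat.prime_dvd_prime_iff_eq hl (by norm_num : Nat.Prime 2)).mp hd
      subst hl'
      exact hne 364 [1, 0, 0, 0, 0, 0] (by norm_num) (by decide +kernel)
    rcases (Nat.Prime.dvd_mul hl).mp hd with hd | hd
    · have hl' := (Nat.prime_dvd_prime_iff_eq hl (by norm_num : Nat.Prime 7)).mp hd
      subst hl'
      exact hne 104 [2, 0, 2, 1, 1, 0] (by norm_num) (by decide +kernel)
    · have hl' := (Nat.prime_dvd_prime_iff_eq hl (by norm_num : Nat.Prime 13)).mp hd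
      subst hl'
      exact hne 56 [1, 0, 1, 1, 1, 0] (by norm_num) (by decide +kernel)
  · have e0 : r ^ 3 ^ 0 = ev r [0, 1, 0, 0, 0, 0] := by simp [ev]
    have e1 := aux_step h3 r r 5 rd6 hr 3 0 2 (by norm_num) _ [0, 0, 0, 1, 0, 0] e0
      (by decide +kernel)
    have e2 := aux_step h3 r r 5 rd6 hr 3 1 2 (by norm_num) _ [0, 0, 0, 1, 1, 0] e1
      (by decide +kernel)
    have e3 := aux_step h3 r r 5 rd6 hr 3 2 2 (by norm_num) _ [1, 2, 1, 1, 1, 0] e2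
      (by decide +kernel)
    have e4 := aux_step h3 r r 5 rd6 hr 3 3 2 (by norm_num) _ [0, 0, 1, 0, 1, 0] e3
      (by decide +kernel)
    have e5 := aux_step h3 r r 5 rd6 hr 3 4 2 (by norm_num) _ [2, 0, 1, 0, 0, 0] e4
      (by decide +kernel)
    refine aux_expl h3 r (ev r [0, 1, 0, 0, 0, 0])
      (ev r [0, 0, 0, 1, 0, 0])
      (ev r [0, 0, 0, 1, 1, 0])
      (ev r [1, 2, 1, 1, 1, 0])
      (ev r [0, 0, 1, 0, 1, 0])
      (ev r [2, 0, 1, 0, 0, 0])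
      (ev r [2, 0, 0, 0, 0, 0])
      (ev r [0, 2, 2, 2, 1, 0]) (by rw [hF]; exact e0) (by rw [hF]; exact e1)
      (by rw [hF]; exact e2) (by rw [hF]; exact e3) (by rw [hF]; exact e4) (by rw [hF]; exact e5)
      ?_ ?_ ?_
    · simp only [← ev_lad h3]
      rw [show lad _ _ = [0, 0, 0, 0, 0, 0] by decide +kernel]
      simp [ev]
    · simp only [← ev_lad h3]
      rw [← ev_lmul h3 r 5 rd6 _ _ hr, show lmul _ _ _ _ = [1, 0, 0, 0, 0, 0] by decide +kernel]
      exact hone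
    · simp only [← ev_lad h3]
      rw [← ev_lmul h3 r 5 rd6 _ _ hr, show lmul _ _ _ _ = [1, 0, 0, 0, 0, 0] by decide +kernel]
      exact hone

theorem expl_12 {F K : Type} [Field F] [Fintype F] [Field K] [Fintype K] [Algebra F K]
    (hF : Fintype.card F = 9) (hr : Module.finrank F K = 6) :
    ∃ α : K, IsPrimitiveElt α ∧ IskNormal (Fintype.card F) 6 1 F α := by
  classical
  have hK : Fintype.card K = 531441 := by
    rw [Module.card_eq_pow_finrank (K := F) (V := K), hr, hF]; norm_num
  have h3 : (3:K) = 0 := h3_of_card (F := F) 2 (by rw [hF]; norm_num)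
  obtain ⟨r, hr⟩ := exists_root h3 11 rd12 rfl (bits 20 531441)
    (by rw [bval_bits _ _ (by norm_num), hK]) (by decide +kernel)
  have hone : ev r [1, 0, 0, 0, 0, 0, 0, 0, 0, 0, 0, 0] = 1 := by simp [ev]
  have hne : ∀ (n : ℕ) (i : List ℕ), n < 2 ^ 20 →
      lmul 11 rd12 i (lad (lpw 11 rd12 [0, 1] (bits 20 n)) [2]) = [1, 0, 0, 0, 0, 0, 0, 0, 0, 0, 0, 0] → r ^ n ≠ 1 := by
    intro n i hn hi
    exact aux_ne_one h3 r 11 rd12 hr _ n (bval_bits _ _ hn) i _ hone hi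
  have hr0 : r ≠ 0 := by
    intro h
    rw [h] at hr
    simp [ev] at hr
  refine ⟨r, ?_, ?_⟩
  · apply aux_prim_of_order r hr0
    intro l hl hd
    rw [hK] at hd ⊢
    rw [show 531441 - 1 = 2 ^ 4 * (5 * (7 * (13 * 73))) by norm_num] at hd
    rcases (Nat.Prime.dvd_mul hl).mp hd with hd | hd
    · replace hd := hl.dvd_of_dvd_pow hd
      have hl' := (Nat.prime_dvd_prime_iff_eq hl (by norm_num : Nat.Prime 2)).mp hd
      subst hl'
      exact hne 265720 [1, 0, 0, 0, 0, 0, 0, 0, 0, 0, 0, 0] (by norm_num) (by decide +kernel)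
    rcases (Nat.Prime.dvd_mul hl).mp hd with hd | hd
    · have hl' := (Nat.prime_dvd_prime_iff_eq hl (by norm_num : Nat.Prime 5)).mp hd
      subst hl'
      exact hne 106288 [1, 0, 1, 1, 2, 1, 0, 0, 2, 0, 0, 0] (by norm_num) (by decide +kernel)
    rcases (Nat.Prime.dvd_mul hl).mp hd with hd | hd
    · have hl' := (Nat.prime_dvd_prime_iff_eq hl (by norm_num : Nat.Prime 7)).mp hd
      subst hl'
      exact hne 75920 [0, 0, 2, 0, 2, 0, 1, 0, 2, 1, 0, 0] (by norm_num) (by decide +kernel)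
    rcases (Nat.Prime.dvd_mul hl).mp hd with hd | hd
    · have hl' := (Nat.prime_dvd_prime_iff_eq hl (by norm_num : Nat.Prime 13)).mp hd
      subst hl'
      exact hne 40880 [0, 0, 1, 2, 2, 0, 1, 2, 1, 2, 2, 2] (by norm_num) (by decide +kernel)
    · have hl' := (Nat.prime_dvd_prime_iff_eq hl (by norm_num : Nat.Prime 73)).mp hd
      subst hl'
      exact hne 7280 [1, 1, 0, 2, 0, 2, 1, 1, 1, 1, 1, 2] (by norm_num) (by decide +kernel)
  · have e0 : r ^ 9 ^ 0 = ev r [0, 1, 0, 0, 0, 0, 0, 0, 0, 0, 0, 0] := by simp [ev]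
    have e1 := aux_step h3 r r 11 rd12 hr 9 0 4 (by norm_num) _ [0, 0, 0, 0, 0, 0, 0, 0, 0, 1, 0, 0] e0
      (by decide +kernel)
    have e2 := aux_step h3 r r 11 rd12 hr 9 1 4 (by norm_num) _ [2, 0, 0, 1, 0, 2, 1, 0, 2, 0, 0, 1] e1
      (by decide +kernel)
    have e3 := aux_step h3 r r 11 rd12 hr 9 2 4 (by norm_num) _ [2, 2, 1, 1, 2, 2, 2, 0, 1, 2, 0, 0] e2
      (by decide +kernel)
    have e4 := aux_step h3 r r 11 rd12 hr 9 3 4 (by norm_num) _ [0, 2, 0, 1, 1, 1, 0, 1, 1, 2, 1, 2] e3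
      (by decide +kernel)
    have e5 := aux_step h3 r r 11 rd12 hr 9 4 4 (by norm_num) _ [2, 1, 2, 0, 0, 1, 0, 2, 2, 1, 2, 0] e4
      (by decide +kernel)
    refine aux_expl h3 r (ev r [0, 1, 0, 0, 0, 0, 0, 0, 0, 0, 0, 0])
      (ev r [0, 0, 0, 0, 0, 0, 0, 0, 0, 1, 0, 0])
      (ev r [2, 0, 0, 1, 0, 2, 1, 0, 2, 0, 0, 1])
      (ev r [2, 2, 1, 1, 2, 2, 2, 0, 1, 2, 0, 0])
      (ev r [0, 2, 0, 1, 1, 1, 0, 1, 1, 2, 1, 2])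
      (ev r [2, 1, 2, 0, 0, 1, 0, 2, 2, 1, 2, 0])
      (ev r [2, 2, 2, 0, 2, 2, 1, 1, 0, 1, 1, 2])
      (ev r [1, 0, 1, 2, 1, 1, 2, 2, 2, 1, 2, 0]) (by rw [hF]; exact e0) (by rw [hF]; exact e1)
      (by rw [hF]; exact e2) (by rw [hF]; exact e3) (by rw [hF]; exact e4) (by rw [hF]; exact e5)
      ?_ ?_ ?_
    · simp only [← ev_lad h3]
      rw [show lad _ _ = [0, 0, 0, 0, 0, 0, 0, 0, 0, 0, 0, 0] by decide +kernel]
      simp [ev]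
    · simp only [← ev_lad h3]
      rw [← ev_lmul h3 r 11 rd12 _ _ hr, show lmul _ _ _ _ = [1, 0, 0, 0, 0, 0, 0, 0, 0, 0, 0, 0] by decide +kernel]
      exact hone
    · simp only [← ev_lad h3]
      rw [← ev_lmul h3 r 11 rd12 _ _ hr, show lmul _ _ _ _ = [1, 0, 0, 0, 0, 0, 0, 0, 0, 0, 0, 0] by decide +kernel]
      exact hone

end explicit2

theorem hp_p0 (F : Type) [Field F] (p : ℕ) [Fact p.Prime] [CharP F p] :
    hp F p 0 = X ^ p - 1 := by
  simp [hp, sub_pow_char]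

theorem hp_pp (F : Type) [Field F] (p : ℕ) [Fact p.Prime] [CharP F p] :
    hp F p p = X ^ (2 * p) - 1 := by
  simp only [hp, map_one, sub_pow_char, add_pow_char, one_pow]
  ring

/-- For `q` a power of an odd prime `p` and `n = p` or `n = 2p`, there is a primitive
`1`-normal element of `F_{qⁿ}` over `F_q`. -/
theorem stmt_16 (p e q n : ℕ) (hp : p.Prime) (hpodd : Odd p) (he : 0 < e) (hq : q = p ^ e)
    (hn : n = p ∨ n = 2 * p)
    (F K : Type) [Field F] [Fintype F] [Field K] [Fintype K] [Algebra F K]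
    (hcF : Fintype.card F = q) (hrK : Module.finrank F K = n) :
    ∃ α : K, IsPrimitiveElt α ∧ IskNormal q n 1 F α := by
  haveI : Fact p.Prime := ⟨hp⟩
  haveI : CharP F p := by
    apply charP_of_card_eq_prime_pow (f := e)
    rw [hcF, hq]
  have hp3 : 3 ≤ p := by
    have := hp.two_le
    rcases hpodd with ⟨t, ht⟩
    omega
  have h1q : 1 ≤ q := hq ▸ Nat.one_le_pow _ _ hp.pos
  have hpq : p ∣ q := hq ▸ dvd_pow_self p he.ne'
  have hqp : p ≤ q := Nat.le_of_dvd (by omega) hpq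
  have hqo : Odd q := hq ▸ hpodd.pow
  have hp0 := hp_p0 F p
  have hpp := hp_pp F p
  have h4 : p ≠ 4 := by rintro rfl; revert hp; norm_num
  have h6 : p ≠ 6 := by rintro rfl; revert hp; norm_num
  rcases hn with rfl | rfl
  · by_cases h3 : n = 3
    · subst h3
      have := aux_case3 (F := F) (K := K) (Qn q 3) hrK hp0 (by rw [hcF]; exact Qn_mul q 3 h1q)
        (by rw [hcF]; exact num3 q e he hq)
      rwa [hcF] at this
    · by_cases h5 : n = 5
      · subst h5
        have := aux_case1 (F := F) (K := K) 4 (Qn q 5) (by norm_num) hrK hp0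
          (by rw [hcF]; exact Qn_mul q 5 h1q) (by rw [hcF]; exact num_p5 q e he hq)
        rwa [hcF] at this
      · have hn7 : 7 ≤ n := by omega
        have hnum := num_p7 n q hp hn7 hqp hpq hpodd hqo
        obtain ⟨a, rfl⟩ : ∃ a, n = a + 1 := ⟨n - 1, by omega⟩
        have := aux_case1 (F := F) (K := K) a (Qn q (a + 1)) (by omega) hrK hp0
          (by rw [hcF]; exact Qn_mul q _ h1q) (by rw [hcF]; exact hnum)
        rwa [hcF] at this
  · by_cases h3 : p = 3
    · subst h3
      by_cases he3 : 3 ≤ e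
      · have := aux_case2 (F := F) (K := K) 2 3 3 (Qn q 6) (by norm_num) (by norm_num) (by norm_num)
          hrK hpp (by rw [hcF]; exact Qn_mul q 6 h1q) (by rw [hcF]; exact num6 q e he3 hq)
        rwa [hcF] at this
      · have : e = 1 ∨ e = 2 := by omega
        rcases this with rfl | rfl
        · have := expl_6 (F := F) (K := K) (by rw [hcF, hq]; norm_num) hrK
          rwa [hcF] at this
        · have := expl_12 (F := F) (K := K) (by rw [hcF, hq]; norm_num) hrK
          rwa [hcF] at this
    · have hn5 : 5 ≤ p := by omega
      have hnum := num10 p q e hp hn5 he hq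
      obtain ⟨a, rfl⟩ : ∃ a, p = a + 1 := ⟨p - 1, by omega⟩
      have h2 : 2 * (a + 1) = a + (a + 1) + 1 := by ring
      have := aux_case2 (F := F) (K := K) a (a + 1) (a + 1) (Qn q (2 * (a + 1))) (by omega)
        (by omega) (by omega) (by rw [hrK, h2]) (by rw [hpp, h2])
        (by rw [hcF, ← h2]; exact Qn_mul q _ h1q)
        (by
          rw [hcF]
          rw [show 2 * (a + 1) - 1 = a + (a + 1) by omega,
            show 2 * (a + 1) - 2 = a + (a + 1) - 1 by omega] at hnum
          exact hnum)
      rw [hcF, ← h2] at this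
      exact this

end
end

section
/- Let n ≥ 3 be odd and let T(x) = (x^n − 1)/(x − 1) ∈ F_2[x]. Then the number W(T) of monic divisors of T in F_2[x] satisfies W(T) ≤ 2^{(n+9)/5}. -/
open Polynomial

noncomputable section

lemma aux_W (T : (ZMod 2)[X]) (hT : Squarefree T) :
    Wpoly T ≤ 2 ^ (UniqueFactorizationMonoid.normalizedFactors T).toFinset.card := by
  classical
  have h0 : T ≠ 0 := hT.ne_zero
  rw [← Finset.card_powerset, ← Set.ncard_coe_finset]
  unfold Wpoly
  refine Set.ncard_le_ncard_of_injOn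
    (fun h => (UniqueFactorizationMonoid.normalizedFactors h).toFinset) ?_ ?_ (Finset.finite_toSet _)
  · rintro h ⟨hm, hd⟩
    simp only [Finset.coe_powerset, Set.mem_preimage, Set.mem_powerset_iff, Finset.coe_subset]
    intro p hp
    rw [Multiset.mem_toFinset] at hp ⊢
    exact Multiset.mem_of_le ((UniqueFactorizationMonoid.dvd_iff_normalizedFactors_le_normalizedFactors
      hm.ne_zero h0).1 hd) hp
  · rintro a ⟨ham, had⟩ b ⟨hbm, hbd⟩ hab
    have key : ∀ c : (ZMod 2)[X], c ∣ T → (UniqueFactorizationMonoid.normalizedFactors c).Nodup :=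
      fun c hc => (UniqueFactorizationMonoid.squarefree_iff_nodup_normalizedFactors
        (ne_zero_of_dvd_ne_zero h0 hc)).1 (hT.squarefree_of_dvd hc)
    have e : UniqueFactorizationMonoid.normalizedFactors a
        = UniqueFactorizationMonoid.normalizedFactors b := by
      have h3 := congrArg Finset.val hab
      simp only [Multiset.toFinset_val] at h3
      rwa [(key a had).dedup, (key b hbd).dedup] at h3
    have h1 := UniqueFactorizationMonoid.prod_normalizedFactors ham.ne_zero
    have h2 := UniqueFactorizationMonoid.prod_normalizedFactors hbm.ne_zero
    rw [e] at h1
    exact eq_of_monic_of_associated ham hbm (h1.symm.trans h2)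

lemma aux_expand (f : (ZMod 2)[X]) (d : ℕ) (hd : f.natDegree = d) :
    f = ∑ i ∈ Finset.range (d+1), C (f.coeff i) * X ^ i := by
  subst hd; exact f.as_sum_range_C_mul_X_pow

lemma aux_z (a : ZMod 2) : a = 0 ∨ a = 1 := by revert a; decide

lemma aux_class (f : (ZMod 2)[X]) (hf : f.Monic) (hi : Irreducible f) (e0 : f.eval 0 ≠ 0)
    (e1 : f.eval 1 ≠ 0) :
    2 ≤ f.natDegree ∧ (f.natDegree = 2 → f = X ^ 2 + X + 1) ∧
    (f.natDegree = 3 → f = X ^ 3 + X + 1 ∨ f = X ^ 3 + X ^ 2 + 1) ∧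
    (f.natDegree = 4 → f = X ^ 4 + X + 1 ∨ f = X ^ 4 + X ^ 3 + 1 ∨
      f = X ^ 4 + X ^ 3 + X ^ 2 + X + 1) := by
  have tw : (1 : ZMod 2) + 1 = 0 := by decide
  have hc0 : f.coeff 0 = 1 := by
    rw [← coeff_zero_eq_eval_zero] at e0
    exact (aux_z _).resolve_left e0
  have hd0 : f.natDegree ≠ 0 := fun h => hi.natDegree_pos.ne' h
  have hl := hf.coeff_natDegree
  refine ⟨?_, ?_, ?_, ?_⟩
  · by_contra hlt
    have h1 : f.natDegree = 1 := by omega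
    have := aux_expand f 1 h1
    rw [h1] at hl
    rw [this] at e1
    simp [Finset.sum_range_succ, hc0, hl, tw] at e1
  · intro h
    have := aux_expand f 2 h
    rw [h] at hl
    rw [this] at e1
    simp only [Finset.sum_range_succ, Finset.range_zero, Finset.sum_empty, hc0, hl] at e1 this
    rcases aux_z (f.coeff 1) with h1 | h1 <;> simp [h1, tw] at e1 this
    rw [this]; ring
  · intro h
    have := aux_expand f 3 h
    rw [h] at hl
    rw [this] at e1
    simp only [Finset.sum_range_succ, Finset.range_zero, Finset.sum_empty, hc0, hl] at e1 this
    rcases aux_z (f.coeff 1) with h1 | h1 <;> rcases aux_z (f.coeff 2) with h2 | h2 <;>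
      simp [h1, h2, tw] at e1 this
    · right; rw [this]; ring
    · left; rw [this]; ring
  · intro h
    have := aux_expand f 4 h
    rw [h] at hl
    rw [this] at e1
    simp only [Finset.sum_range_succ, Finset.range_zero, Finset.sum_empty, hc0, hl] at e1 this
    rcases aux_z (f.coeff 1) with h1 | h1 <;> rcases aux_z (f.coeff 2) with h2 | h2 <;>
      rcases aux_z (f.coeff 3) with h3 | h3 <;>
      simp [h1, h2, h3, tw] at e1 this
    · right; left; rw [this]; ring
    · exfalso
      have t2 : (2 : (ZMod 2)[X]) = 0 := CharTwo.two_eq_zero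
      have hsq : f = (X ^ 2 + X + 1) * (X ^ 2 + X + 1) := by
        rw [this]; linear_combination (-X - X ^ 2 - X ^ 3) * t2
      have hdeg : (X ^ 2 + X + 1 : (ZMod 2)[X]).natDegree = 2 := by compute_degree!
      rcases hi.isUnit_or_isUnit hsq with hu | hu <;>
      · have := natDegree_eq_zero_of_isUnit hu
        omega
    · left; rw [this]; ring
    · right; right; rw [this]; ring

lemma aux_card (F : Finset (ZMod 2)[X]) (hF : ∀ f ∈ F, f.Monic ∧ Irreducible f ∧ f.eval 0 ≠ 0 ∧
    f.eval 1 ≠ 0) : 5 * F.card ≤ ∑ f ∈ F, f.natDegree + 10 := by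
  classical
  have c : ∀ f ∈ F, _ := fun f hf =>
    aux_class f (hF f hf).1 (hF f hf).2.1 (hF f hf).2.2.1 (hF f hf).2.2.2
  have h2 : (F.filter (fun f => f.natDegree = 2)).card ≤ 1 := by
    refine (Finset.card_le_card (t := {X ^ 2 + X + 1}) ?_).trans (by simp)
    intro f hf
    rw [Finset.mem_filter] at hf
    simpa using (c f hf.1).2.1 hf.2
  have h3 : (F.filter (fun f => f.natDegree = 3)).card ≤ 2 := by
    refine (Finset.card_le_card (t := {X ^ 3 + X + 1, X ^ 3 + X ^ 2 + 1}) ?_).trans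
      Finset.card_le_two
    intro f hf
    rw [Finset.mem_filter] at hf
    simpa using (c f hf.1).2.2.1 hf.2
  have h4 : (F.filter (fun f => f.natDegree = 4)).card ≤ 3 := by
    refine (Finset.card_le_card (t := {X ^ 4 + X + 1, X ^ 4 + X ^ 3 + 1,
      X ^ 4 + X ^ 3 + X ^ 2 + X + 1}) ?_).trans Finset.card_le_three
    intro f hf
    rw [Finset.mem_filter] at hf
    simpa using (c f hf.1).2.2.2 hf.2
  have key : ∑ f ∈ F, 5 ≤ ∑ f ∈ F, (f.natDegree + 3 * (if f.natDegree = 2 then 1 else 0)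
      + 2 * (if f.natDegree = 3 then 1 else 0) + (if f.natDegree = 4 then 1 else 0)) := by
    refine Finset.sum_le_sum fun f hf => ?_
    have := (c f hf).1
    split_ifs <;> omega
  simp only [Finset.sum_add_distrib, ← Finset.mul_sum, ← Finset.card_filter, Finset.sum_const,
    smul_eq_mul] at key
  omega

/-- For odd `n ≥ 3` and `T = (xⁿ-1)/(x-1) ∈ F_2[x]`, we have `W(T) ≤ 2^((n+9)/5)`. -/
theorem stmt_17 (n : ℕ) (hn : 3 ≤ n) (hodd : Odd n) :
    (Wpoly ((X ^ n - 1 : (ZMod 2)[X]) /ₘ (X - 1)) : ℝ) ≤ 2 ^ (((n : ℝ) + 9) / 5) := by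
  classical
  have hX : (X - 1 : (ZMod 2)[X]) = X - C 1 := by simp
  have hXm : (X - 1 : (ZMod 2)[X]).Monic := by rw [hX]; exact monic_X_sub_C 1
  set T := (X ^ n - 1 : (ZMod 2)[X]) /ₘ (X - 1) with hTdef
  have hmul : (X - 1) * T = X ^ n - 1 := by
    have : (X - C 1) * ((X ^ n - 1 : (ZMod 2)[X]) /ₘ (X - C 1)) = X ^ n - 1 :=
      mul_divByMonic_eq_iff_isRoot.2 (by simp)
    rwa [← hX] at this
  have hsq' : Squarefree (X ^ n - 1 : (ZMod 2)[X]) := by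
    refine (X_pow_sub_one_separable_iff.2 ?_).squarefree
    rw [hodd.natCast_zmod_two]; decide
  have hsq : Squarefree T := hsq'.squarefree_of_dvd ⟨X - 1, by rw [← hmul]; ring⟩
  have hT0 := hsq.ne_zero
  have hdeg : T.natDegree = n - 1 := by
    have := natDegree_divByMonic (X ^ n - 1 : (ZMod 2)[X]) hXm
    rw [← hTdef] at this
    rw [this, hX, natDegree_X_sub_C, ← C_1, natDegree_X_pow_sub_C]
  have e0 : T.eval 0 ≠ 0 := by
    intro h
    have := congrArg (eval 0) hmul
    simp [h, show n ≠ 0 by omega] at this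
  have e1 : T.eval 1 ≠ 0 := by
    intro h
    have hd : (X - C 1) ∣ T := dvd_iff_isRoot.2 h
    rw [← hX] at hd
    have hu := hsq' (X - 1) (by rw [← hmul]; exact mul_dvd_mul_left _ hd)
    have := natDegree_eq_zero_of_isUnit hu
    rw [hX, natDegree_X_sub_C] at this
    omega
  have hW := aux_W T hsq
  set N := UniqueFactorizationMonoid.normalizedFactors T with hN
  have hnd : N.Nodup := (UniqueFactorizationMonoid.squarefree_iff_nodup_normalizedFactors hT0).1 hsq
  have hmon : ∀ f ∈ N, f.Monic := by
    intro f hf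
    have := UniqueFactorizationMonoid.normalize_normalized_factor f hf
    rw [← this]
    exact monic_normalize (UniqueFactorizationMonoid.irreducible_of_normalized_factor f hf).ne_zero
  have hc := aux_card N.toFinset (by
    intro f hf
    rw [Multiset.mem_toFinset] at hf
    have hd := UniqueFactorizationMonoid.dvd_of_mem_normalizedFactors hf
    exact ⟨hmon f hf, UniqueFactorizationMonoid.irreducible_of_normalized_factor f hf,
      fun h => e0 (eval_eq_zero_of_dvd_of_eval_eq_zero hd h),
      fun h => e1 (eval_eq_zero_of_dvd_of_eval_eq_zero hd h)⟩)
  have hs : ∑ f ∈ N.toFinset, f.natDegree = n - 1 := by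
    have h1 := UniqueFactorizationMonoid.prod_normalizedFactors hT0
    rw [← hN] at h1
    have h2 := natDegree_eq_of_degree_eq (degree_eq_degree_of_associated h1)
    rw [natDegree_multiset_prod_of_monic N hmon, hdeg] at h2
    rw [← h2, Finset.sum, Multiset.toFinset_val, hnd.dedup]
  rw [hs] at hc
  have hc' : 5 * N.toFinset.card ≤ n + 9 := by omega
  calc (Wpoly T : ℝ) ≤ ((2 ^ N.toFinset.card : ℕ) : ℝ) := by exact_mod_cast hW
    _ = (2 : ℝ) ^ ((N.toFinset.card : ℕ) : ℝ) := by rw [Real.rpow_natCast]; push_cast; rfl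
    _ ≤ _ := by
      refine Real.rpow_le_rpow_of_exponent_le (by norm_num) ?_
      rw [le_div_iff₀ (by norm_num)]
      have : (5 : ℝ) * N.toFinset.card ≤ n + 9 := by exact_mod_cast hc'
      linarith

end
end

section
/- Let q be a power of an odd prime p and let s be a positive integer with gcd(p, s) = 1. Then every prime divisor r of (q^{ps} − 1)/(q^s − 1) satisfies r ≡ 1 (mod 2p). -/
open Polynomial

noncomputable section

/-- For `q` a power of an odd prime `p` and `gcd(p, s) = 1`, every prime divisor `r` of
`(q^{ps} - 1)/(qˢ - 1)` satisfies `r ≡ 1 (mod 2p)`. -/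
theorem stmt_18 (p e q s : ℕ) (hp : p.Prime) (hpodd : Odd p) (he : 0 < e) (hq : q = p ^ e)
    (hs : 0 < s) (hps : Nat.gcd p s = 1) (r : ℕ) (hr : r.Prime)
    (hdvd : r ∣ (q ^ (p * s) - 1) / (q ^ s - 1)) :
    r % (2 * p) = 1 := by
  haveI := Fact.mk hr
  have hq1 : 1 < q ^ s := by
    rw [hq, ← pow_mul]
    exact Nat.one_lt_pow (by positivity) hp.one_lt
  have hgeom : (q ^ (p * s) - 1) / (q ^ s - 1) = ∑ i ∈ Finset.range p, (q ^ s) ^ i := by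
    rw [Nat.geomSum_eq hq1, ← pow_mul, mul_comm s p]
  rw [hgeom] at hdvd
  have hz : ∑ i ∈ Finset.range p, ((q ^ s : ℕ) : ZMod r) ^ i = 0 := by
    have := (ZMod.natCast_eq_zero_iff _ r).2 hdvd
    simpa only [Nat.cast_sum, Nat.cast_pow] using this
  have hap : ((q ^ s : ℕ) : ZMod r) ^ p = 1 := by
    have := geom_sum_mul ((q ^ s : ℕ) : ZMod r) p
    rw [hz, zero_mul] at this
    exact (sub_eq_zero.1 this.symm)
  have ha1 : ((q ^ s : ℕ) : ZMod r) ≠ 1 := by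
    intro h
    rw [h] at hz
    simp only [one_pow, Finset.sum_const, Finset.card_range, nsmul_eq_mul, mul_one] at hz
    have h0 : ((q ^ s : ℕ) : ZMod r) = 0 := by
      rw [hq]
      push_cast
      rw [hz, zero_pow he.ne', zero_pow hs.ne']
    rw [h0] at h
    exact zero_ne_one h
  have ha0 : ((q ^ s : ℕ) : ZMod r) ≠ 0 := by
    intro h
    rw [h, zero_pow hp.ne_zero] at hap
    exact zero_ne_one hap
  haveI := Fact.mk hp
  have hord : orderOf ((q ^ s : ℕ) : ZMod r) = p := orderOf_eq_prime hap ha1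
  have hd : p ∣ r - 1 := by
    rw [← hord]
    exact orderOf_dvd_of_pow_eq_one (ZMod.pow_card_sub_one_eq_one ha0)
  have hr2 : r ≠ 2 := by
    rintro rfl
    have := Nat.le_of_dvd (by norm_num) hd
    have := hp.two_le
    omega
  have h2 : 2 ∣ r - 1 := (hr.even_sub_one hr2).two_dvd
  have h2p : 2 * p ∣ r - 1 :=
    Nat.Coprime.mul_dvd_of_dvd_of_dvd (Nat.coprime_two_left.2 hpodd) h2 hd
  obtain ⟨k, hk⟩ := h2p
  have hre : r = 1 + 2 * p * k := by
    have := hr.one_lt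
    omega
  rw [hre, Nat.add_mul_mod_self_left]
  apply Nat.mod_eq_of_lt
  have := hp.two_le
  omega

end
end

section
/- Let q be a prime power, n a positive integer, α ∈ F_{q^n}, and define g_α(x) = Σ_{i=0}^{n−1} α^{q^i} x^{n−1−i} ∈ F_{q^n}[x]. Then the greatest common divisor of x^n − 1 and g_α(x) in F_{q^n}[x] has degree k if and only if α is a k-normal element of F_{q^n} over F_q. -/
open Polynomial

noncomputable section

def gPol {F K : Type} [Field F] [Field K] [Algebra F K] (n : ℕ) (s : K →ₗ[F] K) (b : K) : K[X] :=
  ∑ i ∈ Finset.range n, C ((s ^ i) b) * X ^ (n - 1 - i)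

section aux
variable {F K : Type} [Field F] [Field K] [Algebra F K] (n : ℕ) (s : K →ₗ[F] K)

lemma gPol_add (a b : K) : gPol n s (a + b) = gPol n s a + gPol n s b := by
  simp [gPol, add_mul, Finset.sum_add_distrib]

lemma gPol_smul (c : F) (b : K) : gPol n s (c • b) = C (algebraMap F K c) * gPol n s b := by
  simp only [gPol, Finset.mul_sum, map_smul]
  refine Finset.sum_congr rfl fun i _ => ?_
  rw [Algebra.smul_def, C_mul, mul_assoc]

lemma gPol_step (hn : 0 < n) (h1 : s ^ n = 1) (b : K) :
    X * gPol n s b - gPol n s (s b) = C b * (X ^ n - 1) := by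
  obtain ⟨m, rfl⟩ : ∃ m, n = m + 1 := ⟨n - 1, by omega⟩
  have e1 : X * gPol (m + 1) s b = ∑ i ∈ Finset.range (m + 1), C ((s ^ i) b) * X ^ (m + 1 - i) := by
    rw [gPol, Finset.mul_sum]
    refine Finset.sum_congr rfl fun i hi => ?_
    have : m + 1 - i = (m + 1 - 1 - i) + 1 := by
      have := Finset.mem_range.1 hi
      omega
    rw [this, pow_succ]; ring
  have e2 : gPol (m + 1) s (s b)
      = ∑ i ∈ Finset.range (m + 1), C ((s ^ (i + 1)) b) * X ^ (m + 1 - (i + 1)) := by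
    rw [gPol]
    refine Finset.sum_congr rfl fun i hi => ?_
    rw [pow_succ, Module.End.mul_apply]
    congr 2; omega
  rw [e1, e2, ← Finset.sum_sub_distrib,
    Finset.sum_range_sub' (fun i => C ((s ^ i) b) * X ^ (m + 1 - i)), h1]
  simp; ring

lemma gPol_act (hn : 0 < n) (h1 : s ^ n = 1) (p : F[X]) (b : K) :
    (X ^ n - 1 : K[X]) ∣ p.map (algebraMap F K) * gPol n s b - gPol n s (aeval s p b) := by
  induction p using Polynomial.induction_on generalizing b with
  | C a => simp [gPol_smul]
  | add p q hp hq =>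
    have := dvd_add (hp b) (hq b)
    convert this using 1
    simp [gPol_add]; ring
  | monomial k a h =>
    have h2 := h (s b)
    have h3 : (X ^ n - 1 : K[X]) ∣ X * gPol n s b - gPol n s (s b) :=
      ⟨C b, by rw [gPol_step n s hn h1]; ring⟩
    have := dvd_add h2 (h3.mul_left ((C a * X ^ k : F[X]).map (algebraMap F K)))
    convert this using 1
    have : aeval s (C a * X ^ (k + 1)) b = aeval s (C a * X ^ k) (s b) := by
      simp [pow_succ]
    rw [this]
    simp [pow_succ]; ring

lemma gPol_dvd (hn : 0 < n) (b : K) : (X ^ n - 1 : K[X]) ∣ gPol n s b ↔ b = 0 := by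
  constructor
  · intro h
    have hd : (gPol n s b).degree < (X ^ n - 1 : K[X]).degree := by
      rw [show (X ^ n - 1 : K[X]) = X ^ n - C 1 by simp, degree_X_pow_sub_C hn]
      refine (degree_sum_le _ _).trans_lt ?_
      refine (Finset.sup_lt_iff (WithBot.bot_lt_coe n)).2 ?_
      intro i hi
      refine (degree_C_mul_X_pow_le _ _).trans_lt ?_
      have := Finset.mem_range.1 hi
      exact WithBot.coe_lt_coe.2 (by omega : n - 1 - i < n)
    have h0 := eq_zero_of_dvd_of_degree_lt h hd
    have hc := congrArg (fun p => coeff p (n - 1)) h0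
    simp only [gPol, finsetSum_coeff, coeff_C_mul, coeff_X_pow, coeff_zero] at hc
    rw [Finset.sum_eq_single 0] at hc
    · simpa using hc
    · intro i hi h0
      have := Finset.mem_range.1 hi
      rw [if_neg (by omega), mul_zero]
    · intro h; exact absurd (Finset.mem_range.2 hn) h
  · rintro rfl; simp [gPol]

end aux

open scoped Classical in
lemma main_aux {F K : Type} [Field F] [Field K] [Algebra F K] (n : ℕ) (s : K →ₐ[F] K)
    (hn : 0 < n) (h1 : s.toLinearMap ^ n = 1)
    (hfix : ∀ x, s x = x → x ∈ Set.range (algebraMap F K)) (b : K) :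
    Module.finrank F (LinearMap.range
      ((LinearMap.applyₗ b).comp (aeval s.toLinearMap : F[X] →ₐ[F] (K →ₗ[F] K)).toLinearMap)) +
      (EuclideanDomain.gcd (X ^ n - 1 : K[X]) (gPol n s.toLinearMap b)).natDegree = n := by
  set g := gPol n s.toLinearMap b with hg
  set P : K[X] := X ^ n - 1 with hP
  have hPC : P = X ^ n - C 1 := by simp [hP]
  have hPm : P.Monic := by rw [hPC]; exact monic_X_pow_sub_C _ hn.ne'
  have hPdeg : P.natDegree = n := by rw [hPC]; exact natDegree_X_pow_sub_C
  have hP0 : P ≠ 0 := hPm.ne_zero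
  set D := EuclideanDomain.gcd P g with hD
  have hDP : D ∣ P := EuclideanDomain.gcd_dvd_left _ _
  have hDg : D ∣ g := EuclideanDomain.gcd_dvd_right _ _
  have hD0 : D ≠ 0 := fun h => hP0 (by rw [h] at hDP; exact zero_dvd_iff.1 hDP)
  -- Galois stability
  have hmg : g.map (s : K →+* K) = gPol n s.toLinearMap (s b) := by
    simp only [hg, gPol, Polynomial.map_sum, Polynomial.map_mul, Polynomial.map_pow, map_X, map_C]
    refine Finset.sum_congr rfl fun i hi => ?_
    congr 2
    have := congrArg (fun f => f b) (Commute.self_pow s.toLinearMap i).eq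
    simpa [Module.End.mul_apply] using this
  have hmP : P.map (s : K →+* K) = P := by simp [hP]
  have hmD : D.map (s : K →+* K) ∣ D := by
    have a1 : D.map (s : K →+* K) ∣ P := by
      have := Polynomial.map_dvd (s : K →+* K) hDP
      rwa [hmP] at this
    have a2 : D.map (s : K →+* K) ∣ X * g := by
      have := Polynomial.map_dvd (s : K →+* K) hDg
      rw [hmg] at this
      have e := gPol_step n s.toLinearMap hn h1 b
      have e' : X * g = gPol n s.toLinearMap (s b) + C b * P := by
        rw [hP, ← e]; simp [hg]
      rw [e']
      exact dvd_add this (a1.mul_left _)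
    have a3 : IsCoprime P X := by
      refine ⟨-1, X ^ (n - 1), ?_⟩
      rw [← pow_succ, Nat.sub_add_cancel hn, hP]; ring
    have a4 : D.map (s : K →+* K) ∣ g :=
      (a3.of_isCoprime_of_dvd_left a1).dvd_of_dvd_mul_left a2
    exact EuclideanDomain.dvd_gcd a1 a4
  -- normalised
  set E := normalize D with hE
  have hEm : E.Monic := monic_normalize hD0
  have hED : Associated E D := normalize_associated D
  have hmE : E.map (s : K →+* K) = E := by
    have : E.map (s : K →+* K) ∣ E :=
      ((Polynomial.map_dvd _ hED.dvd).trans hmD).trans hED.dvd'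
    exact (eq_of_monic_of_dvd_of_natDegree_le (hEm.map _) hEm this (by simp)).symm
  obtain ⟨M, hM⟩ := hED.dvd.trans hDP
  have hMm : M.Monic := hEm.of_mul_monic_left (hM ▸ hPm)
  have hmM : M.map (s : K →+* K) = M := by
    have := congrArg (Polynomial.map (s : K →+* K)) hM
    rw [hmP, Polynomial.map_mul, hmE, hM] at this
    exact (mul_left_cancel₀ hEm.ne_zero this).symm
  have hlift : M ∈ lifts (algebraMap F K) := by
    rw [lifts_iff_coeff_lifts]
    intro i
    apply hfix
    have := congrArg (fun p => coeff p i) hmM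
    simpa using this
  obtain ⟨M0, hM0, hM0d, hM0m⟩ := lifts_and_natDegree_eq_and_monic hlift hMm
  have hker : LinearMap.ker ((LinearMap.applyₗ b).comp
      (aeval s.toLinearMap : F[X] →ₐ[F] (K →ₗ[F] K)).toLinearMap)
      = (Ideal.span {M0}).restrictScalars F := by
    ext p
    simp only [LinearMap.mem_ker, LinearMap.comp_apply, AlgHom.toLinearMap_apply,
      LinearMap.applyₗ_apply_apply, Submodule.restrictScalars_mem, Ideal.mem_span_singleton]
    rw [← gPol_dvd n s.toLinearMap hn, ← map_dvd_map' (algebraMap F K), hM0]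
    rw [← hP, ← (dvd_iff_dvd_of_dvd_sub (gPol_act n s.toLinearMap hn h1 p b)), ← hg]
    constructor
    · intro h
      obtain ⟨u, v, huv⟩ : ∃ u v, D = P * u + g * v :=
        ⟨_, _, EuclideanDomain.gcd_eq_gcd_ab P g⟩
      have h2 : P ∣ p.map (algebraMap F K) * D := by
        rw [huv, mul_add]
        refine dvd_add ⟨p.map (algebraMap F K) * u, by ring⟩ ?_
        rw [← mul_assoc]; exact h.mul_right _
      have h3 : P ∣ p.map (algebraMap F K) * E :=
        h2.trans (mul_dvd_mul_left _ hED.dvd')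
      rw [hM, mul_comm] at h3
      exact (mul_dvd_mul_iff_right hEm.ne_zero).1 h3
    · intro h
      rw [← hP, hM, mul_comm]
      exact mul_dvd_mul h (hED.dvd.trans hDg)
  have hfr : Module.finrank F (LinearMap.range
      ((LinearMap.applyₗ b).comp (aeval s.toLinearMap : F[X] →ₐ[F] (K →ₗ[F] K)).toLinearMap))
      = M.natDegree := by
    rw [← (LinearMap.quotKerEquivRange _).finrank_eq, hker, ← hM0d]
    exact finrank_quotient_span_eq_natDegree
  rw [hfr, ← hPdeg, hM, hEm.natDegree_mul hMm, add_comm]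
  congr 1
  exact (natDegree_eq_of_degree_eq (degree_eq_degree_of_associated hED)).symm

open scoped Classical in
/-- For `g_α(x) = Σ_{i<n} α^(qⁱ) x^(n-1-i) ∈ F_{qⁿ}[x]`, the gcd of `xⁿ - 1` and `g_α`
has degree `k` iff `α` is `k`-normal over `F_q`. -/
theorem stmt_19 (q n k : ℕ) (hq : IsPrimePow q) (hn : 0 < n) (hk : k ≤ n)
    (F K : Type) [Field F] [Fintype F] [Field K] [Fintype K] [Algebra F K]
    (hcF : Fintype.card F = q) (hrK : Module.finrank F K = n) (α : K) :
    (EuclideanDomain.gcd ((X : K[X]) ^ n - 1)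
        (∑ i ∈ Finset.range n, C (α ^ q ^ i) * X ^ (n - 1 - i))).natDegree = k ↔
      IskNormal q n k F α := by
  subst hcF
  set s := FiniteField.frobeniusAlgHom F K with hs
  have hpow : ∀ (i : ℕ) (x : K), (s.toLinearMap ^ i) x = x ^ Fintype.card F ^ i := by
    intro i x
    rw [Module.End.coe_pow]
    change (fun y : K => y ^ Fintype.card F)^[i] x = _
    rw [pow_iterate]
  have h1 : s.toLinearMap ^ n = 1 := by
    ext x
    rw [hpow, ← hrK, ← Module.card_eq_pow_finrank, FiniteField.pow_card]; rfl
  have hfix : ∀ x, s x = x → x ∈ Set.range (algebraMap F K) := by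
    intro x hx
    refine (IsGalois.mem_bot_iff_fixed (F := F) x).2 fun f => ?_
    obtain ⟨i, rfl⟩ := (FiniteField.bijective_frobeniusAlgEquivOfAlgebraic_pow F K).2 f
    simp only [AlgEquiv.coe_pow]
    exact Function.iterate_fixed hx _
  have key := main_aux n s hn h1 hfix α
  have hg : gPol n s.toLinearMap α
      = ∑ i ∈ Finset.range n, C (α ^ Fintype.card F ^ i) * X ^ (n - 1 - i) := by
    simp only [gPol, hpow]
  rw [hg] at key
  have hspan : LinearMap.range
      ((LinearMap.applyₗ α).comp (aeval s.toLinearMap : F[X] →ₐ[F] (K →ₗ[F] K)).toLinearMap)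
      = Submodule.span F (Set.range fun i : Fin n => α ^ Fintype.card F ^ (i : ℕ)) := by
    apply le_antisymm
    · rintro _ ⟨p, rfl⟩
      simp only [LinearMap.comp_apply, AlgHom.toLinearMap_apply, LinearMap.applyₗ_apply_apply]
      rw [aeval_eq_sum_range, LinearMap.sum_apply]
      refine Submodule.sum_mem _ fun i _ => ?_
      rw [LinearMap.smul_apply]
      refine Submodule.smul_mem _ _ (Submodule.subset_span ⟨⟨i % n, Nat.mod_lt _ hn⟩, ?_⟩)
      simp only
      rw [← hpow, ← pow_eq_pow_mod i h1]
    · rw [Submodule.span_le]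
      rintro _ ⟨i, rfl⟩
      refine ⟨X ^ (i : ℕ), ?_⟩
      simp [← hpow]
  rw [hspan] at key
  unfold IskNormal
  omega

end
end
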